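/- arXiv:1312.6267 — 3 statements merged into one kernel-verified Lean document; each statement's English description precedes it below -/
import Mathlib

section
/- Let G be a connected algebraic group over a field k with character group Ĝ(X) = Hom(G ×_k X, G_m) of X-families of characters, and let X be a reduced k-scheme. Then the multiplication map μ : Ĝ(X) × O(X)^* → O(G × X)^*, (χ, f) ↦ ((g,x) ↦ χ(x)(g)·f(x)), is a group isomorphism. In particular every unit u on G × X with u(e_G, x) = 1 for all x is of the form u(g,x) = χ(x)(g) for a unique character family χ. -/
open TensorProduct

universe u

section Hopf

variable (k : Type u) [Field k] (A : Type u) [CommRing A] [HopfAlgebra k A]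
variable (R : Type u) [CommRing R] [Algebra k R]

/-- Evaluation of a function on `G × X` at the identity of `G`:
the algebra homomorphism `O(G × X) = A ⊗ O(X) → O(X)` induced by the counit of the
Hopf algebra `A = O(G)`. -/
noncomputable def evalAtIdentity : A ⊗[k] R →ₐ[k] R :=
  (Algebra.TensorProduct.lid k R).toAlgHom.comp
    (Algebra.TensorProduct.map (Bialgebra.counitAlgHom k A) (AlgHom.id k R))

/-- An `X`-family of characters of `G` (an element of `Ĝ(X)`), where `G = Spec A` is an
affine algebraic group with Hopf algebra `A` and `X = Spec R`: a unit `u` of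
`O(G × X) = A ⊗ R` satisfying `u(gh, x) = u(g, x)·u(h, x)`, i.e. the comultiplication of
`A` (tensored with `R`) sends `u` to the product of its two pull-backs along the
projections `G × G × X → G × X`. -/
def IsCharacterFamily (u : (A ⊗[k] R)ˣ) : Prop :=
  Units.map (Algebra.TensorProduct.map (Bialgebra.comulAlgHom k A)
      (AlgHom.id k R)).toRingHom.toMonoidHom u =
    Units.map (Algebra.TensorProduct.map
        (Algebra.TensorProduct.includeLeft : A →ₐ[k] A ⊗[k] A)
        (AlgHom.id k R)).toRingHom.toMonoidHom u *
      Units.map (Algebra.TensorProduct.map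
        (Algebra.TensorProduct.includeRight : A →ₐ[k] A ⊗[k] A)
        (AlgHom.id k R)).toRingHom.toMonoidHom u

end Hopf

/-- If `A` is formally smooth over `k` and `f : P → A` is surjective with kernel contained in `M`,
then `A` embeds into the `M`-adic completion of `P` as soon as `A` is `f(M)`-adically separated. -/
theorem Algebra.FormallySmooth.exists_injective_algHom_adicCompletion
    {k A P : Type*} [CommRing k] [CommRing A] [CommRing P] [Algebra k A] [Algebra k P]
    [Algebra.FormallySmooth k A] (f : P →ₐ[k] A) (hf : Function.Surjective f) (M : Ideal P)
    (hM : RingHom.ker f ≤ M) (hsep : ⨅ n : ℕ, (M.map f) ^ n = ⊥) :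
    ∃ g : A →ₐ[k] AdicCompletion M P, Function.Injective g := by
  obtain ⟨s, hs⟩ := Algebra.FormallySmooth.exists_kerProj_comp_eq_id f hf
  let J := RingHom.ker f
  let t : AdicCompletion J P →ₐ[P] AdicCompletion M P :=
    AdicCompletion.liftAlgHom M
      (fun n ↦ (Ideal.Quotient.factorₐ P (Ideal.pow_right_mono hM n)).comp
        (AdicCompletion.evalₐ J n)) (by
      intro m n hle
      ext x
      obtain ⟨x, rfl⟩ := AdicCompletion.mk_surjective J P x
      simp only [AlgHom.comp_apply, AdicCompletion.evalₐ_mk]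
      have h := AdicCompletion.Ideal.mk_eq_mk J hle x
      exact congr(Ideal.Quotient.factorₐ P (Ideal.pow_right_mono hM m) $h))
  refine ⟨(t.restrictScalars k).comp s, (injective_iff_map_eq_zero _).2 fun a ha ↦ ?_⟩
  have key (n : ℕ) : a ∈ (M.map f) ^ (n + 1) := by
    obtain ⟨x, hx⟩ := AdicCompletion.mk_surjective J P (s a)
    have h1 : AdicCompletion.evalₐ M (n + 1) (t (s a)) = 0 := by
      have : t (s a) = 0 := ha
      simp [this]
    have h2 : x (n + 1) ∈ M ^ (n + 1) := by
      rw [← Ideal.Quotient.eq_zero_iff_mem, ← h1, ← hx]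
      refine Eq.trans ?_ (AdicCompletion.evalₐ_liftAlgHom M _ _ (n + 1) _).symm
      simp only [AlgHom.comp_apply, AdicCompletion.evalₐ_mk]
      rfl
    have h3 : f (x (n + 1)) = a := by
      have h4 : AdicCompletion.kerProj hf (s a) = a := congr($hs a)
      have h5 : AdicCompletion.evalOneₐ J (s a) = Ideal.Quotient.mk J (x (n + 1)) := by
        rw [← hx]
        simp only [AdicCompletion.evalOneₐ, AlgHom.comp_apply, AdicCompletion.evalₐ_mk]
        have h := AdicCompletion.Ideal.mk_eq_mk J (Nat.le_add_left 1 n) x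
        have h' := congr(Ideal.Quotient.factorₐ P (pow_one J).le $h)
        simpa using! h'.symm
      rw [← h4]
      simp only [AdicCompletion.kerProj, AlgHom.comp_apply, AlgHom.restrictScalars_apply]
      erw [h5]
      simp [J]
    rw [← Ideal.map_pow, ← h3]
    exact Ideal.mem_map_of_mem _ h2
  have : a ∈ ⨅ n : ℕ, (M.map f) ^ n := by
    refine (Ideal.mem_iInf).2 fun n ↦ Ideal.pow_le_pow_right (Nat.le_succ n) (key n)
  simpa [hsep] using this

theorem exists_injective_algHom_mvPowerSeries
    {k A : Type*} [Field k] [CommRing A] [IsDomain A] [Algebra k A]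
    [Algebra.FormallySmooth k A] [Algebra.FiniteType k A] (ε : A →ₐ[k] k) :
    ∃ (n : ℕ) (g : A →ₐ[k] MvPowerSeries (Fin n) k), Function.Injective g := by
  obtain ⟨n, f₀, hf₀⟩ := (Algebra.FiniteType.iff_quotient_mvPolynomial'' (R := k) (S := A)).1
    inferInstance
  let f : MvPolynomial (Fin n) k →ₐ[k] A :=
    MvPolynomial.aeval fun i ↦ f₀ (.X i) - algebraMap k A (ε (f₀ (.X i)))
  have hf : Function.Surjective f := by
    rw [← AlgHom.range_eq_top, eq_top_iff, ← (AlgHom.range_eq_top f₀).2 hf₀]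
    rintro _ ⟨p, rfl⟩
    induction p using MvPolynomial.induction_on with
    | C a => exact ⟨.C a, by simp [f]⟩
    | add p q hp hq => simpa using! add_mem hp hq
    | mul_X p i hp =>
      have : f₀ (.X i) ∈ f.range := ⟨.X i + .C (ε (f₀ (.X i))), by simp [f]⟩
      simpa using! mul_mem hp this
  let M := MvPolynomial.idealOfVars (Fin n) k
  have hε : ε.comp f = MvPolynomial.aeval (fun _ ↦ (0 : k)) := by
    ext i
    simp [f]
  have hM : RingHom.ker f ≤ M := by
    intro p hp
    rw [← pow_one M, MvPolynomial.mem_pow_idealOfVars_iff']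
    intro x hx
    obtain rfl : x = 0 := by simpa [Finsupp.degree_eq_zero_iff] using hx
    have : ε (f p) = 0 := by rw [(RingHom.mem_ker).1 hp, map_zero]
    rw [← AlgHom.comp_apply, hε] at this
    simpa [MvPolynomial.aeval_zero'] using! this
  have hle : M.map f ≤ RingHom.ker ε := by
    rw [Ideal.map_le_iff_le_comap]
    refine Ideal.span_le.2 ?_
    rintro _ ⟨i, rfl⟩
    simp [f, RingHom.mem_ker]
  have : IsNoetherianRing A := Algebra.FiniteType.isNoetherianRing k A
  obtain ⟨g, hg⟩ := Algebra.FormallySmooth.exists_injective_algHom_adicCompletion f hf M hM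
    (Ideal.iInf_pow_eq_bot_of_isDomain _ fun h ↦ RingHom.ker_ne_top ε (top_le_iff.1 (h ▸ hle)))
  let e := (MvPowerSeries.toAdicCompletionAlgEquiv (Fin n) k).symm.restrictScalars k
  exact ⟨n, e.toAlgHom.comp g, e.injective.comp hg⟩

theorem exists_injective_tensorProduct_algHom_mvPowerSeries
    {k A κ σ : Type*} [Field k] [CommRing A] [Algebra k A]
    [Field κ] [Algebra k κ] (g : A →ₐ[k] MvPowerSeries σ k) (hg : Function.Injective g) :
    ∃ h : A ⊗[k] κ →ₐ[k] MvPowerSeries σ κ, Function.Injective h := by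
  let h : A ⊗[k] κ →ₐ[k] MvPowerSeries σ κ := Algebra.TensorProduct.lift
    ((MvPowerSeries.mapAlgHom (Algebra.ofId k κ)).comp g)
    (IsScalarTower.toAlgHom k κ (MvPowerSeries σ κ)) (fun _ _ ↦ .all _ _)
  refine ⟨h, (injective_iff_map_eq_zero _).2 fun z hz ↦ ?_⟩
  classical
  let b := Module.Basis.ofVectorSpace k κ
  obtain ⟨c, rfl⟩ := (TensorProduct.equivFinsuppOfBasisRight (M := A) b).symm.surjective z
  rw [TensorProduct.equivFinsuppOfBasisRight_symm_apply, Finsupp.sum] at hz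
  suffices c = 0 by simp [this]
  ext i
  by_contra hi
  refine hi (hg ?_)
  ext d
  have hd : ∑ i ∈ c.support, MvPowerSeries.coeff d (g (c i)) • b i = 0 := by
    have := congr(MvPowerSeries.coeff d $hz)
    simpa [h, MvPowerSeries.algebraMap_apply, Algebra.smul_def, Algebra.ofId_apply] using! this
  simpa using linearIndependent_iff'.1 b.linearIndependent _ _ hd i (by simpa using hi)

/-- A smooth affine integral `k`-scheme with a rational point is geometrically integral. -/
theorem isDomain_tensorProduct_of_formallySmooth
    {k A : Type*} [Field k] [CommRing A] [IsDomain A] [Algebra k A]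
    [Algebra.FormallySmooth k A] [Algebra.FiniteType k A] (ε : A →ₐ[k] k)
    (κ : Type*) [Field κ] [Algebra k κ] : IsDomain (A ⊗[k] κ) := by
  obtain ⟨n, g, hg⟩ := exists_injective_algHom_mvPowerSeries ε
  obtain ⟨h, hh⟩ := exists_injective_tensorProduct_algHom_mvPowerSeries (κ := κ) g hg
  have : IsDomain (MvPowerSeries (Fin n) κ) := NoZeroDivisors.to_isDomain _
  exact hh.isDomain h.toRingHom

section Units

variable {k A : Type*} [CommRing k] [CommRing A] [Algebra k A]

theorem TensorProduct.equivFinsuppOfBasisLeft_lTensor {ι M N N' : Type*} [DecidableEq ι]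
    [AddCommGroup M] [Module k M] [AddCommGroup N] [Module k N] [AddCommGroup N'] [Module k N']
    (b : Module.Basis ι k M) (g : N →ₗ[k] N') (z : M ⊗[k] N) (i : ι) :
    equivFinsuppOfBasisLeft b (g.lTensor M z) i = g (equivFinsuppOfBasisLeft b z i) := by
  induction z <;> simp_all

theorem TensorProduct.equivFinsuppOfBasisLeft_one_tmul_mul {ι N : Type*} [DecidableEq ι]
    [CommRing N] [Algebra k N]
    (b : Module.Basis ι k A) (c : N) (z : A ⊗[k] N) (i : ι) :
    equivFinsuppOfBasisLeft b ((1 ⊗ₜ c) * z) i = c * equivFinsuppOfBasisLeft b z i := by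
  induction z <;> simp_all [mul_add]

theorem TensorProduct.equivFinsuppOfBasisLeft_map {ι N N' : Type*} [DecidableEq ι]
    [CommRing N] [Algebra k N] [CommRing N'] [Algebra k N']
    (b : Module.Basis ι k A) (g : N →ₐ[k] N') (z : A ⊗[k] N) (i : ι) :
    equivFinsuppOfBasisLeft b (Algebra.TensorProduct.map (.id k A) g z) i =
      g (equivFinsuppOfBasisLeft b z i) :=
  equivFinsuppOfBasisLeft_lTensor b g.toLinearMap z i

end Units

section Valuation

variable {k A V L ι : Type*} [Field k] [CommRing A] [Algebra k A]
  [CommRing V] [IsDomain V] [ValuationRing V] [Field L] [Algebra V L] [IsFractionRing V L]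
  [Algebra k V] [Algebra k L] [IsScalarTower k V L] [DecidableEq ι]

theorem exists_eq_one_tmul_mul_map_of_ne_zero (b : Module.Basis ι k A) {z : A ⊗[k] L} (hz : z ≠ 0) :
    ∃ (c : L) (Z : A ⊗[k] V) (i : ι),
      z = (1 ⊗ₜ c) * Algebra.TensorProduct.map (.id k A) (IsScalarTower.toAlgHom k V L) Z ∧
      equivFinsuppOfBasisLeft b Z i = 1 := by
  set f := equivFinsuppOfBasisLeft b z with hf
  have hne : f.support.Nonempty := by simpa [hf] using hz
  obtain ⟨i, hi, hmax⟩ := f.support.exists_max_image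
    (fun l ↦ ValuationRing.valuation V L (f l)) hne
  have hi0 : f i ≠ 0 := by simpa using hi
  have hex (l : ι) : ∃ a : V, algebraMap V L a = (f i)⁻¹ * f l := by
    rw [← ValuationRing.mem_integer_iff, Valuation.mem_integer_iff, map_mul, map_inv₀]
    by_cases hl : f l = 0
    · simp [hl]
    · rw [inv_mul_le_one₀ (by simpa [zero_lt_iff] using hi0)]
      exact hmax l (by simpa using hl)
  choose a ha using hex
  let Z : A ⊗[k] V := ∑ l ∈ f.support, b l ⊗ₜ a l
  have hZ : z = (1 ⊗ₜ f i) *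
      Algebra.TensorProduct.map (.id k A) (IsScalarTower.toAlgHom k V L) Z := by
    rw [← (equivFinsuppOfBasisLeft b).symm_apply_apply z, equivFinsuppOfBasisLeft_symm_apply,
      ← hf, Finsupp.sum]
    simp [Z, Finset.mul_sum, ha, mul_inv_cancel_left₀ hi0]
  refine ⟨f i, Z, i, hZ, FaithfulSMul.algebraMap_injective V L ?_⟩
  have := congr(equivFinsuppOfBasisLeft b $hZ i)
  rw [equivFinsuppOfBasisLeft_one_tmul_mul, equivFinsuppOfBasisLeft_map, ← hf] at this
  simpa using! mul_left_cancel₀ hi0 (this.symm.trans (mul_one _).symm)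

end Valuation

section Hopf

variable {k A : Type u} [Field k] [CommRing A] [HopfAlgebra k A]

@[simp]
theorem evalAtIdentity_tmul {N : Type u} [CommRing N] [Algebra k N] (a : A) (x : N) :
    evalAtIdentity k A N (a ⊗ₜ x) = Coalgebra.counit (R := k) a • x := by
  simp [evalAtIdentity]

theorem evalAtIdentity_one_tmul {N : Type u} [CommRing N] [Algebra k N] (x : N) :
    evalAtIdentity k A N (1 ⊗ₜ x) = x := by
  simp

theorem evalAtIdentity_map {N N' : Type u} [CommRing N] [Algebra k N] [CommRing N'] [Algebra k N']
    (g : N →ₐ[k] N') (z : A ⊗[k] N) :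
    evalAtIdentity k A N' (Algebra.TensorProduct.map (.id k A) g z) =
      g (evalAtIdentity k A N z) := by
  induction z <;> simp_all

theorem TensorProduct.map_id_injective {B N N' : Type*} [CommRing B] [Algebra k B]
    [CommRing N] [Algebra k N] [CommRing N'] [Algebra k N']
    (g : N →ₐ[k] N') (hg : Function.Injective g) :
    Function.Injective (Algebra.TensorProduct.map (.id k B) g) :=
  Module.Flat.lTensor_preserves_injective_linearMap g.toLinearMap hg

/-- A unit on `G × Spec L` that is `1` at the identity has all its coefficients in every valuation
ring `V` of `L` over `k`, provided that `G` remains integral over the residue field of `V`. -/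
theorem exists_algebraMap_eq_equivFinsuppOfBasisLeft {V L : Type u} {ι : Type*} [CommRing V]
    [IsDomain V] [ValuationRing V] [Field L] [Algebra V L] [IsFractionRing V L] [Algebra k V]
    [Algebra k L] [IsScalarTower k V L] [DecidableEq ι]
    [IsDomain (A ⊗[k] IsLocalRing.ResidueField V)] (b : Module.Basis ι k A)
    {u v : A ⊗[k] L} (huv : u * v = 1) (hu : evalAtIdentity k A L u = 1) (l : ι) :
    ∃ a : V, algebraMap V L a = equivFinsuppOfBasisLeft b u l := by
  let toL := IsScalarTower.toAlgHom k V L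
  let res := IsScalarTower.toAlgHom k V (IsLocalRing.ResidueField V)
  have hv : evalAtIdentity k A L v = 1 := by
    simpa [hu] using congr(evalAtIdentity k A L $huv)
  have : Nontrivial (A ⊗[k] L) := (evalAtIdentity k A L).toRingHom.domain_nontrivial
  obtain ⟨c, U, i, hU, hUi⟩ := exists_eq_one_tmul_mul_map_of_ne_zero (V := V) b
    (left_ne_zero_of_mul_eq_one huv)
  obtain ⟨d, W, j, hW, hWj⟩ := exists_eq_one_tmul_mul_map_of_ne_zero (V := V) b
    (right_ne_zero_of_mul_eq_one huv)
  set e := evalAtIdentity k A V U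
  set f := evalAtIdentity k A V W
  have hc : c * toL e = 1 := by
    rw [← hu, hU, map_mul, evalAtIdentity_one_tmul, evalAtIdentity_map]
  have hd : d * toL f = 1 := by
    rw [← hv, hW, map_mul, evalAtIdentity_one_tmul, evalAtIdentity_map]
  have hUW : U * W = 1 ⊗ₜ (e * f) := by
    apply TensorProduct.map_id_injective toL (FaithfulSMul.algebraMap_injective V L)
    have h1 : ((1 : A) ⊗ₜ[k] (toL e * toL f)) * ((1 : A) ⊗ₜ[k] (c * d)) = 1 := by
      rw [Algebra.TensorProduct.tmul_mul_tmul, Algebra.TensorProduct.one_def, mul_one,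
        show toL e * toL f * (c * d) = (c * toL e) * (d * toL f) by ring, hc, hd, mul_one]
    have h2 : ((1 : A) ⊗ₜ[k] (c * d)) * (Algebra.TensorProduct.map (.id k A) toL (U * W)) = 1 := by
      rw [← huv, hU, hW, map_mul, ← mul_one (1 : A), ← Algebra.TensorProduct.tmul_mul_tmul, mul_one]
      exact mul_mul_mul_comm _ _ _ _
    rw [Algebra.TensorProduct.map_tmul, map_mul toL, map_one]
    exact (left_inv_eq_right_inv h1 h2).symm
  have hne {Z : A ⊗[k] V} {i : ι} (hZ : equivFinsuppOfBasisLeft b Z i = 1) :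
      Algebra.TensorProduct.map (.id k A) res Z ≠ 0 := by
    intro h
    have := equivFinsuppOfBasisLeft_map b res Z i
    simp [h, hZ] at this
  have he : IsUnit e := by
    rw [← IsLocalRing.residue_ne_zero_iff_isUnit]
    intro h
    refine mul_ne_zero (hne hUi) (hne hWj) ?_
    have h' : res e = 0 := h
    rw [← map_mul, hUW, Algebra.TensorProduct.map_tmul, map_mul, h', zero_mul, tmul_zero]
  obtain ⟨e', he'⟩ := he.exists_left_inv
  refine ⟨e' * equivFinsuppOfBasisLeft b U l, ?_⟩
  have : algebraMap V L e' = c := by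
    refine left_inv_eq_right_inv (a := algebraMap V L e) ?_ ((mul_comm _ _).trans hc)
    rw [← map_mul, he', map_one]
  rw [hU, equivFinsuppOfBasisLeft_one_tmul_mul, equivFinsuppOfBasisLeft_map, map_mul, this]
  rfl

/-- If `G` is geometrically integral, a unit on `G × Spec L` that is `1` at the identity has
coefficients integral over `k`. -/
theorem isIntegral_equivFinsuppOfBasisLeft {L : Type u} {ι : Type*} [Field L] [Algebra k L]
    [DecidableEq ι] (hA : ∀ (κ : Type u) [Field κ] [Algebra k κ], IsDomain (A ⊗[k] κ))
    (b : Module.Basis ι k A) {u v : A ⊗[k] L} (huv : u * v = 1)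
    (hu : evalAtIdentity k A L u = 1) (l : ι) :
    IsIntegral k (equivFinsuppOfBasisLeft b u l) := by
  by_contra hl
  let S := (integralClosure k L).toSubring
  have : IsIntegrallyClosedIn S L := inferInstanceAs (IsIntegrallyClosedIn (integralClosure k L) L)
  obtain ⟨V, hSV, hV⟩ := Subring.exists_le_valuationSubring_of_isIntegrallyClosedIn (R := S) hl
  let : Algebra k V := ((algebraMap k L).codRestrict V.toSubring fun x ↦
    hSV (algebraMap_mem (integralClosure k L) x)).toAlgebra
  have : IsScalarTower k V L := .of_algebraMap_eq' rfl
  have := hA (IsLocalRing.ResidueField V)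
  obtain ⟨a, ha⟩ := exists_algebraMap_eq_equivFinsuppOfBasisLeft (V := V) b huv hu l
  exact hV (ha ▸ a.2)

end Hopf

section Comul

variable {k A : Type u} [Field k] [CommRing A] [HopfAlgebra k A]
variable (k A) (R : Type u) [CommRing R] [Algebra k R]

/-- Pullback of functions along `G × (G × X) → G × X`, `(g, (h, x)) ↦ (gh, x)`. -/
noncomputable def comulAssoc : A ⊗[k] R →ₐ[k] A ⊗[k] (A ⊗[k] R) :=
  (Algebra.TensorProduct.assoc k k k A A R).toAlgHom.comp
    (Algebra.TensorProduct.map (Bialgebra.comulAlgHom k A) (.id k R))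

variable {k A R}

theorem evalAtIdentity_comulAssoc (z : A ⊗[k] R) :
    evalAtIdentity k A (A ⊗[k] R) (comulAssoc k A R z) = z := by
  induction z with
  | zero => simp
  | add x y hx hy => simp [hx, hy]
  | tmul a r =>
    have h (t : A ⊗[k] A) :
        evalAtIdentity k A (A ⊗[k] R) (Algebra.TensorProduct.assoc k k k A A R (t ⊗ₜ r)) =
          TensorProduct.lid k A ((Coalgebra.counit (R := k)).rTensor A t) ⊗ₜ r := by
      induction t with
      | zero => simp
      | add x y hx hy => simp only [add_tmul, map_add, hx, hy]
      | tmul x y => simp [smul_tmul']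
    simpa [comulAssoc] using! h (Coalgebra.comul a)

theorem map_evalAtIdentity_comulAssoc (z : A ⊗[k] R) :
    Algebra.TensorProduct.map (.id k A) (evalAtIdentity k A R) (comulAssoc k A R z) = z := by
  induction z with
  | zero => simp
  | add x y hx hy => simp [hx, hy]
  | tmul a r =>
    have h (t : A ⊗[k] A) :
        Algebra.TensorProduct.map (.id k A) (evalAtIdentity k A R)
          (Algebra.TensorProduct.assoc k k k A A R (t ⊗ₜ r)) =
          TensorProduct.rid k A ((Coalgebra.counit (R := k)).lTensor A t) ⊗ₜ r := by
      induction t with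
      | zero => simp
      | add x y hx hy => simp only [add_tmul, map_add, hx, hy]
      | tmul x y => simp [smul_tmul']
    simpa [comulAssoc] using! h (Coalgebra.comul a)

theorem eq_one_tmul_of_isIntegral {K : Type u} [Field K] [Algebra k K] [IsDomain (A ⊗[k] K)]
    {x : A ⊗[k] K} (hx : IsIntegral k x) : x = 1 ⊗ₜ evalAtIdentity k A K x := by
  by_contra hne
  have hint : IsIntegral k (x - 1 ⊗ₜ evalAtIdentity k A K x) :=
    hx.sub ((hx.map (evalAtIdentity k A K)).map
      (Algebra.TensorProduct.includeRight : K →ₐ[k] A ⊗[k] K))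
  have hunit := IsArtinianRing.isUnit_of_isIntegral_of_nonZeroDivisor hint
    (mem_nonZeroDivisors_of_ne_zero (sub_ne_zero.2 hne))
  simpa [evalAtIdentity_one_tmul] using hunit.map (evalAtIdentity k A K)

theorem comulAssoc_eq_mul {K : Type u} [Field K] [Algebra k K]
    (hA : ∀ (κ : Type u) [Field κ] [Algebra k κ], IsDomain (A ⊗[k] κ))
    {u v : A ⊗[k] K} (huv : u * v = 1) (hu : evalAtIdentity k A K u = 1) :
    comulAssoc k A K u =
      Algebra.TensorProduct.map (.id k A) Algebra.TensorProduct.includeRight u * 1 ⊗ₜ u := by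
  classical
  have := hA K
  have hv : evalAtIdentity k A K v = 1 := by
    simpa [hu] using congr(evalAtIdentity k A K $huv)
  let toL := IsScalarTower.toAlgHom k (A ⊗[k] K) (FractionRing (A ⊗[k] K))
  have htoL : Function.Injective toL := FaithfulSMul.algebraMap_injective _ _
  let b := Module.Basis.ofVectorSpace k A
  set w := comulAssoc k A K u * 1 ⊗ₜ v with hw
  have hww : w * (comulAssoc k A K v * 1 ⊗ₜ u) = 1 := by
    rw [hw, mul_mul_mul_comm, ← map_mul, huv, map_one, one_mul,
      Algebra.TensorProduct.tmul_mul_tmul, mul_comm v, huv, one_mul]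
    rfl
  have hεw : evalAtIdentity k A _ w = 1 := by
    rw [hw, map_mul, evalAtIdentity_comulAssoc, evalAtIdentity_one_tmul, huv]
  have hint (l) : IsIntegral k (equivFinsuppOfBasisLeft b w l) := by
    rw [← isIntegral_algHom_iff toL htoL, ← equivFinsuppOfBasisLeft_map]
    refine isIntegral_equivFinsuppOfBasisLeft hA b
      (v := Algebra.TensorProduct.map (.id k A) toL (comulAssoc k A K v * 1 ⊗ₜ u)) ?_ ?_ l
    · rw [← map_mul, hww, map_one]
    · rw [evalAtIdentity_map, hεw, map_one]
  have hmap : w = Algebra.TensorProduct.map (.id k A)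
      (Algebra.TensorProduct.includeRight.comp (evalAtIdentity k A K)) w := by
    apply (equivFinsuppOfBasisLeft b).injective
    ext l
    rw [equivFinsuppOfBasisLeft_map]
    exact eq_one_tmul_of_isIntegral (hint l)
  have hmap' : w = Algebra.TensorProduct.map (.id k A) Algebra.TensorProduct.includeRight u := by
    rw [hmap, ← AlgHom.id_comp (AlgHom.id k A), Algebra.TensorProduct.map_comp,
      AlgHom.comp_apply, hw, map_mul, map_evalAtIdentity_comulAssoc,
      Algebra.TensorProduct.map_tmul, hv]
    simp [← Algebra.TensorProduct.one_def]
  rw [← hmap', hw, mul_assoc, Algebra.TensorProduct.tmul_mul_tmul, mul_comm v, huv, one_mul,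
    ← Algebra.TensorProduct.one_def, mul_one]

variable (k A R) in
/-- The difference of the two sides of the equation `u(gh, x) = u(g, x) u(h, x)`. -/
noncomputable def characterDefect (u : A ⊗[k] R) : (A ⊗[k] A) ⊗[k] R :=
  Algebra.TensorProduct.map (Bialgebra.comulAlgHom k A) (.id k R) u -
    Algebra.TensorProduct.map (Algebra.TensorProduct.includeLeft : A →ₐ[k] A ⊗[k] A) (.id k R) u *
      Algebra.TensorProduct.map (Algebra.TensorProduct.includeRight : A →ₐ[k] A ⊗[k] A) (.id k R) u

theorem isCharacterFamily_iff (u : (A ⊗[k] R)ˣ) :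
    IsCharacterFamily k A R u ↔ characterDefect k A R u = 0 := by
  rw [IsCharacterFamily, Units.ext_iff, characterDefect, sub_eq_zero]
  rfl

theorem map_characterDefect {S : Type u} [CommRing S] [Algebra k S] (g : R →ₐ[k] S)
    (u : A ⊗[k] R) :
    Algebra.TensorProduct.map (.id k (A ⊗[k] A)) g (characterDefect k A R u) =
      characterDefect k A S (Algebra.TensorProduct.map (.id k A) g u) := by
  simp only [characterDefect, map_sub, map_mul, ← AlgHom.comp_apply,
    ← Algebra.TensorProduct.map_comp, AlgHom.id_comp, AlgHom.comp_id]

theorem characterDefect_eq_zero_of_field {K : Type u} [Field K] [Algebra k K]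
    (hA : ∀ (κ : Type u) [Field κ] [Algebra k κ], IsDomain (A ⊗[k] κ))
    {u v : A ⊗[k] K} (huv : u * v = 1) (hu : evalAtIdentity k A K u = 1) :
    characterDefect k A K u = 0 := by
  apply (Algebra.TensorProduct.assoc k k k A A K).injective
  have h1 : Algebra.TensorProduct.assoc k k k A A K
      (Algebra.TensorProduct.map (Algebra.TensorProduct.includeLeft : A →ₐ[k] A ⊗[k] A) (.id k K) u) =
      Algebra.TensorProduct.map (.id k A) Algebra.TensorProduct.includeRight u := by
    clear huv hu
    induction u <;> simp_all
  have h2 : Algebra.TensorProduct.assoc k k k A A K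
      (Algebra.TensorProduct.map (Algebra.TensorProduct.includeRight : A →ₐ[k] A ⊗[k] A) (.id k K) u) = 1 ⊗ₜ u := by
    clear huv hu h1
    induction u <;> simp_all [tmul_add]
  rw [characterDefect, map_sub, map_mul, h1, h2, map_zero, sub_eq_zero]
  exact comulAssoc_eq_mul hA huv hu

theorem TensorProduct.eq_zero_of_forall_residueField {B : Type*} [CommRing B] [Algebra k B]
    [IsReduced R] (z : B ⊗[k] R)
    (hz : ∀ (p : Ideal R) [p.IsPrime], Algebra.TensorProduct.map (.id k B)
      (IsScalarTower.toAlgHom k R p.ResidueField) z = 0) : z = 0 := by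
  classical
  let b := Module.Basis.ofVectorSpace k B
  apply (equivFinsuppOfBasisLeft b).injective
  ext l
  rw [map_zero, Finsupp.zero_apply]
  refine IsReduced.eq_zero _ (nilpotent_iff_mem_prime.2 fun p hp ↦ ?_)
  rw [← Ideal.algebraMap_residueField_eq_zero]
  have := equivFinsuppOfBasisLeft_map b (IsScalarTower.toAlgHom k R p.ResidueField) z l
  rw [hz, map_zero, Finsupp.zero_apply] at this
  exact this.symm

theorem isCharacterFamily_of_evalAtIdentity_eq_one [IsReduced R]
    (hA : ∀ (κ : Type u) [Field κ] [Algebra k κ], IsDomain (A ⊗[k] κ))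
    (u : (A ⊗[k] R)ˣ) (hu : evalAtIdentity k A R u = 1) : IsCharacterFamily k A R u := by
  refine (isCharacterFamily_iff u).2 (TensorProduct.eq_zero_of_forall_residueField _ fun p _ ↦ ?_)
  rw [map_characterDefect]
  refine characterDefect_eq_zero_of_field hA (v := Algebra.TensorProduct.map (.id k A)
    (IsScalarTower.toAlgHom k R p.ResidueField) (u⁻¹ : (A ⊗[k] R)ˣ)) ?_ ?_
  · rw [← map_mul, u.mul_inv, map_one]
  · rw [evalAtIdentity_map, hu, map_one]

theorem IsCharacterFamily.evalAtIdentity_eq_one {u : (A ⊗[k] R)ˣ}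
    (hu : IsCharacterFamily k A R u) : evalAtIdentity k A R u = 1 := by
  rw [isCharacterFamily_iff, characterDefect, sub_eq_zero] at hu
  have hmul := congr(evalAtIdentity k A R (evalAtIdentity k A (A ⊗[k] R)
    (Algebra.TensorProduct.assoc k k k A A R $hu)))
  have h0 : evalAtIdentity k A (A ⊗[k] R) (Algebra.TensorProduct.assoc k k k A A R
      (Algebra.TensorProduct.map (Bialgebra.comulAlgHom k A) (.id k R) (u : A ⊗[k] R))) = u :=
    evalAtIdentity_comulAssoc _
  have h1 (z : A ⊗[k] R) : evalAtIdentity k A R (evalAtIdentity k A (A ⊗[k] R)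
      (Algebra.TensorProduct.assoc k k k A A R
      (Algebra.TensorProduct.map (Algebra.TensorProduct.includeLeft : A →ₐ[k] A ⊗[k] A) (.id k R) z))) =
      evalAtIdentity k A R z := by
    induction z <;> simp_all
  have h2 (z : A ⊗[k] R) : evalAtIdentity k A R (evalAtIdentity k A (A ⊗[k] R)
      (Algebra.TensorProduct.assoc k k k A A R
      (Algebra.TensorProduct.map (Algebra.TensorProduct.includeRight : A →ₐ[k] A ⊗[k] A) (.id k R) z))) =
      evalAtIdentity k A R z := by
    induction z <;> simp_all
  rw [h0, map_mul, map_mul, map_mul, h1, h2] at hmul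
  exact (u.isUnit.map (evalAtIdentity k A R)).mul_left_cancel (hmul.symm.trans (mul_one _).symm)

end Comul

/-- Let `G = Spec A` be a connected (smooth, affine) algebraic group
over a field `k` (so `A` is an integral finitely generated smooth Hopf `k`-algebra) and
let `X = Spec R` be a reduced `k`-scheme.  Then the multiplication map
`μ : Ĝ(X) × O(X)^* → O(G × X)^*`, `(χ, f) ↦ ((g,x) ↦ χ(x)(g)·f(x))` is a group
isomorphism: the character families form a subgroup, `μ` is multiplicative (which holds
by definition) and bijective.  In particular every unit `u` on `G × X` with
`u(e_G, x) = 1` identically is an `X`-family of characters. -/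
theorem units_of_group_times_reduced_scheme
    (k : Type u) [Field k] (A : Type u) [CommRing A] [HopfAlgebra k A]
    [IsDomain A] (hfg : Algebra.FiniteType k A) (hsm : Algebra.FormallySmooth k A)
    (R : Type u) [CommRing R] [Algebra k R] [IsReduced R] :
    -- the character families form a subgroup of `O(G × X)^*`
    IsCharacterFamily k A R 1 ∧
    (∀ u v : (A ⊗[k] R)ˣ, IsCharacterFamily k A R u → IsCharacterFamily k A R v →
      IsCharacterFamily k A R (u * v)) ∧
    (∀ u : (A ⊗[k] R)ˣ, IsCharacterFamily k A R u → IsCharacterFamily k A R u⁻¹) ∧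
    -- `μ` is a bijection `Ĝ(X) × O(X)^* ≃ O(G × X)^*`
    Function.Bijective (fun p : {u : (A ⊗[k] R)ˣ // IsCharacterFamily k A R u} × Rˣ =>
      p.1.1 * Units.map (Algebra.TensorProduct.includeRight :
        R →ₐ[k] A ⊗[k] R).toRingHom.toMonoidHom p.2) ∧
    -- units normalized at the identity are character families
    (∀ u : (A ⊗[k] R)ˣ,
      Units.map (evalAtIdentity k A R).toRingHom.toMonoidHom u = 1 →
      IsCharacterFamily k A R u) := by
  have hA (κ : Type u) [Field κ] [Algebra k κ] : IsDomain (A ⊗[k] κ) :=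
    isDomain_tensorProduct_of_formallySmooth (Bialgebra.counitAlgHom k A) κ
  have hchar (u : (A ⊗[k] R)ˣ)
      (hu : Units.map (evalAtIdentity k A R).toRingHom.toMonoidHom u = 1) :
      IsCharacterFamily k A R u :=
    isCharacterFamily_of_evalAtIdentity_eq_one hA u congr(($hu : R))
  have hone (u : (A ⊗[k] R)ˣ) (hu : IsCharacterFamily k A R u) :
      Units.map (evalAtIdentity k A R).toRingHom.toMonoidHom u = 1 :=
    Units.ext hu.evalAtIdentity_eq_one
  have hincl (f : Rˣ) : Units.map (evalAtIdentity k A R).toRingHom.toMonoidHom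
      (Units.map (Algebra.TensorProduct.includeRight :
        R →ₐ[k] A ⊗[k] R).toRingHom.toMonoidHom f) = f :=
    Units.ext (evalAtIdentity_one_tmul (f : R))
  refine ⟨hchar 1 (map_one _), fun u v hu hv ↦ hchar _ ?_, fun u hu ↦ hchar _ ?_,
    ⟨?_, fun u ↦ ?_⟩, hchar⟩
  · rw [map_mul, hone u hu, hone v hv, one_mul]
  · rw [map_inv, hone u hu, inv_one]
  · rintro ⟨⟨u, hu⟩, f⟩ ⟨⟨v, hv⟩, g⟩ h
    have hfg' : f = g := by
      have := congr(Units.map (evalAtIdentity k A R).toRingHom.toMonoidHom $h)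
      simpa only [map_mul, hincl, hone u hu, hone v hv, one_mul] using this
    subst hfg'
    obtain rfl : u = v := mul_right_cancel h
    rfl
  · set f := Units.map (evalAtIdentity k A R).toRingHom.toMonoidHom u with hf
    set j := Units.map (Algebra.TensorProduct.includeRight :
      R →ₐ[k] A ⊗[k] R).toRingHom.toMonoidHom
    refine ⟨⟨⟨u * (j f)⁻¹, hchar _ ?_⟩, f⟩, inv_mul_cancel_right u (j f)⟩
    rw [map_mul, map_inv, hincl, ← hf, mul_inv_cancel]
end

section
/- Let G be a connected algebraic group and X a reduced scheme over k. If f is a unit on G × G × X such that f(e_G, g, x) = 1 = f(g, e_G, x) identically, then f = 1. -/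
open TensorProduct

universe u

namespace MvPolynomial

variable {σ K : Type*} [Field K]

theorem mem_pow_idealOfVars_iff_le_order (n : ℕ) (p : MvPolynomial σ K) :
    p ∈ idealOfVars σ K ^ n ↔ (n : ℕ∞) ≤ (p : MvPowerSeries σ K).order := by
  rw [mem_pow_idealOfVars_iff']
  refine ⟨fun h ↦ MvPowerSeries.nat_le_order fun d hd ↦ by simpa using h d hd, fun h d hd ↦ ?_⟩
  rw [← coeff_coe]
  exact MvPowerSeries.coeff_of_lt_order (lt_of_lt_of_le (by exact_mod_cast hd) h)

theorem mem_pow_idealOfVars_or_mem_of_mul_mem {n : ℕ} {p q : MvPolynomial σ K}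
    (h : p * q ∈ idealOfVars σ K ^ (n + n)) :
    p ∈ idealOfVars σ K ^ n ∨ q ∈ idealOfVars σ K ^ n := by
  simp only [mem_pow_idealOfVars_iff_le_order, coe_mul, MvPowerSeries.order_mul] at h ⊢
  by_contra! hlt
  exact absurd h (not_le.mpr (by push_cast; exact ENat.add_lt_add hlt.1 hlt.2))

/-- The linear form with the given coefficients. -/
noncomputable def linearForm (σ K : Type*) [Field K] : (σ →₀ K) →ₗ[K] MvPolynomial σ K :=
  Finsupp.linearCombination K X

theorem linearForm_mem_idealOfVars (c : σ →₀ K) : linearForm σ K c ∈ idealOfVars σ K := by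
  rw [linearForm, Finsupp.linearCombination_apply]
  exact Ideal.sum_mem _ fun i _ ↦ Submodule.smul_of_tower_mem _ _ (Ideal.subset_span ⟨i, rfl⟩)

theorem sub_C_constantCoeff_mem_idealOfVars (p : MvPolynomial σ K) :
    p - C (constantCoeff p) ∈ idealOfVars σ K := by
  rw [← pow_one (idealOfVars σ K), mem_pow_idealOfVars_iff']
  intro d hd
  obtain rfl : d = 0 := (Finsupp.degree_eq_zero_iff d).mp (Nat.lt_one_iff.mp hd)
  simp [constantCoeff_eq]

theorem exists_sub_linearForm_mem {p : MvPolynomial σ K} (hp : p ∈ idealOfVars σ K) :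
    ∃ c, p - linearForm σ K c ∈ idealOfVars σ K ^ 2 := by
  induction hp using Submodule.span_induction with
  | mem p hp =>
    obtain ⟨i, rfl⟩ := hp
    exact ⟨Finsupp.single i 1, by simp [linearForm]⟩
  | zero => exact ⟨0, by simp⟩
  | add p q _ _ hp hq =>
    obtain ⟨c, hc⟩ := hp
    obtain ⟨d, hd⟩ := hq
    exact ⟨c + d, by simpa [add_sub_add_comm] using add_mem hc hd⟩
  | smul a p hp' hp =>
    obtain ⟨c, hc⟩ := hp
    refine ⟨constantCoeff a • c, ?_⟩
    have : a • p - linearForm σ K (constantCoeff a • c) =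
        a * (p - linearForm σ K c) + (a - C (constantCoeff a)) * linearForm σ K c := by
      rw [map_smul, smul_eq_C_mul, smul_eq_mul]; ring
    rw [this]
    refine add_mem (Ideal.mul_mem_left _ _ hc) ?_
    rw [pow_two]
    exact Ideal.mul_mem_mul (sub_C_constantCoeff_mem_idealOfVars a) (linearForm_mem_idealOfVars c)

end MvPolynomial

section Smooth

open MvPolynomial

variable {K B : Type u} [Field K] [CommRing B] [Algebra K B]

/-- Choosing functions at a rational point whose differentials form a basis of the cotangent
space identifies the first-order neighbourhood of the point with that of affine space. -/
theorem exists_cotangent_coordinates (ε : B →ₐ[K] K) :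
    ∃ (σ : Type u) (h : MvPolynomial σ K →ₐ[K] B),
      (∀ p ∈ idealOfVars σ K, h p ∈ RingHom.ker ε) ∧
      (∀ a ∈ RingHom.ker ε, ∃ p ∈ idealOfVars σ K, a - h p ∈ RingHom.ker ε ^ 2) ∧
      (∀ p ∈ idealOfVars σ K, h p ∈ RingHom.ker ε ^ 2 → p ∈ idealOfVars σ K ^ 2) := by
  set m : Ideal B := RingHom.ker ε with hm
  let b := Module.Basis.ofVectorSpace K m.Cotangent
  let σ := Module.Basis.ofVectorSpaceIndex K m.Cotangent
  choose x hx using fun i : σ ↦ m.toCotangent_surjective (b i)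
  let h : MvPolynomial σ K →ₐ[K] B := aeval fun i ↦ (x i : B)
  have hlin (c : σ →₀ K) : h (linearForm σ K c) = (Finsupp.linearCombination K x c : m) := by
    simp [h, linearForm, Finsupp.linearCombination_apply, Finsupp.sum]
  have hcot (c : σ →₀ K) : m.toCotangent (Finsupp.linearCombination K x c) =
      Finsupp.linearCombination K b c := by
    have := Finsupp.apply_linearCombination K (m.toCotangent.restrictScalars K) x c
    rwa [show (m.toCotangent.restrictScalars K) ∘ x = b from funext hx] at this
  have hI : ∀ p ∈ idealOfVars σ K, h p ∈ m := by
    intro p hp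
    have : idealOfVars σ K ≤ m.comap h := by
      rw [idealOfVars, Ideal.span_le]
      rintro _ ⟨i, rfl⟩
      simp [h]
    exact this hp
  have hI2 : ∀ p ∈ idealOfVars σ K ^ 2, h p ∈ m ^ 2 := by
    intro p hp
    have := Ideal.pow_right_mono (Ideal.map_le_iff_le_comap.mpr
      (show idealOfVars σ K ≤ m.comap h from hI)) 2
    rw [← Ideal.map_pow] at this
    exact this (Ideal.mem_map_of_mem h hp)
  refine ⟨σ, h, hI, fun a ha ↦ ?_, fun p hp hpm ↦ ?_⟩
  · refine ⟨linearForm σ K (b.repr (m.toCotangent ⟨a, ha⟩)), linearForm_mem_idealOfVars _, ?_⟩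
    rw [hlin]
    refine (m.toCotangent_eq (x := ⟨a, ha⟩)).mp ?_
    rw [hcot, b.linearCombination_repr]
  · obtain ⟨c, hc⟩ := exists_sub_linearForm_mem hp
    have h1 : h (linearForm σ K c) ∈ m ^ 2 := by
      have := sub_mem hpm (hI2 _ hc)
      rwa [← map_sub, sub_sub_cancel] at this
    rw [hlin, ← m.toCotangent_eq_zero, hcot] at h1
    have hc0 : c = 0 := by
      have := congrArg b.repr h1
      rwa [b.repr_linearCombination, map_zero] at this
    simpa [hc0] using hc

/-- Coordinates which generate the ideal of the point modulo its square approximate every function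
to any order. -/
theorem exists_polynomial_approx {σ : Type u} (ε : B →ₐ[K] K) (h : MvPolynomial σ K →ₐ[K] B)
    (h1 : ∀ p ∈ idealOfVars σ K, h p ∈ RingHom.ker ε)
    (h2 : ∀ a ∈ RingHom.ker ε, ∃ p ∈ idealOfVars σ K, a - h p ∈ RingHom.ker ε ^ 2) (n : ℕ)
    (a : B) : ∃ p, a - h p ∈ RingHom.ker ε ^ n := by
  set m : Ideal B := RingHom.ker ε with hm
  have key (n : ℕ) : ∀ a ∈ m ^ n, ∃ p, a - h p ∈ m ^ (n + 1) := by
    induction n with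
    | zero =>
      refine fun a _ ↦ ⟨C (ε a), ?_⟩
      have : h (C (ε a)) = algebraMap K B (ε a) := h.commutes _
      simp [hm, this]
    | succ n ih =>
      intro a ha
      rw [pow_succ] at ha
      induction ha using Submodule.mul_induction_on' with
      | mem_mul_mem a ha b hb =>
        obtain ⟨p, hp⟩ := ih a ha
        obtain ⟨q, hq, hq'⟩ := h2 b hb
        refine ⟨p * q, ?_⟩
        have : a * b - h (p * q) = (a - h p) * h q + a * (b - h q) := by
          rw [map_mul]; ring
        rw [this]
        refine add_mem ?_ ?_
        · rw [pow_succ]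
          exact Ideal.mul_mem_mul hp (h1 q hq)
        · rw [add_assoc, pow_add]
          exact Ideal.mul_mem_mul ha hq'
      | add a _ b _ ha hb =>
        obtain ⟨p, hp⟩ := ha
        obtain ⟨q, hq⟩ := hb
        exact ⟨p + q, by simpa [add_sub_add_comm] using add_mem hp hq⟩
  induction n with
  | zero => exact ⟨0, by simp⟩
  | succ n ih =>
    obtain ⟨p, hp⟩ := ih
    obtain ⟨q, hq⟩ := key n _ hp
    exact ⟨p + q, by rwa [map_add, ← sub_sub]⟩

/-- A separated formally smooth algebra at a rational point has no zero divisors. -/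
theorem isDomain_of_formallySmooth_of_iInf_pow_eq_bot [Algebra.FormallySmooth K B]
    (ε : B →ₐ[K] K) (hε : ⨅ n : ℕ, RingHom.ker ε ^ n = ⊥) : IsDomain B := by
  obtain ⟨σ, h, h1, h2, h3⟩ := exists_cotangent_coordinates ε
  set m : Ideal B := RingHom.ker ε with hm
  let I := idealOfVars σ K
  have happ := exists_polynomial_approx ε h h1 h2
  have hpow (n : ℕ) : ∀ p ∈ I ^ n, h p ∈ m ^ n := by
    intro p hp
    have := Ideal.pow_right_mono (Ideal.map_le_iff_le_comap.mpr (show I ≤ m.comap h from h1)) n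
    rw [← Ideal.map_pow] at this
    exact this (Ideal.mem_map_of_mem h hp)
  have : Nontrivial B := ε.toRingHom.domain_nontrivial
  have hεh (p : MvPolynomial σ K) : ε (h p) = constantCoeff p := by
    have h4 := h1 _ (sub_C_constantCoeff_mem_idealOfVars p)
    rw [map_sub, hm, RingHom.mem_ker, map_sub, sub_eq_zero] at h4
    rw [h4]
    exact (ε.comp h).commutes _
  have hsurj : Function.Surjective ((Ideal.Quotient.mkₐ K (m ^ 2)).comp h) := by
    intro y
    obtain ⟨a, rfl⟩ := Ideal.Quotient.mk_surjective y
    obtain ⟨p, hp⟩ := happ 2 a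
    exact ⟨p, (Ideal.Quotient.eq.mpr hp).symm⟩
  have hker : I ^ 2 = RingHom.ker ((Ideal.Quotient.mkₐ K (m ^ 2)).comp h) := by
    ext p
    simp only [RingHom.mem_ker, AlgHom.comp_apply, Ideal.Quotient.mkₐ_eq_mk,
      Ideal.Quotient.eq_zero_iff_mem]
    refine ⟨hpow 2 p, fun hp ↦ h3 p ?_ hp⟩
    have : constantCoeff p = 0 := by
      rw [← hεh]; exact Ideal.pow_le_self two_ne_zero hp
    simpa [this] using sub_C_constantCoeff_mem_idealOfVars p
  let g : B →ₐ[K] MvPolynomial σ K ⧸ I ^ 2 :=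
    ((Ideal.quotientEquivAlgOfEq K hker).trans
      (Ideal.quotientKerAlgEquivOfSurjective hsurj)).symm.toAlgHom.comp
      (Ideal.Quotient.mkₐ K (m ^ 2))
  have hg (p : MvPolynomial σ K) : g (h p) = Ideal.Quotient.mk _ p := by
    simp only [g, AlgHom.comp_apply, AlgEquiv.toAlgHom_apply]
    rw [AlgEquiv.symm_apply_eq]
    rfl
  have main (n : ℕ) (hn : 1 ≤ n) (a b : B) (hab : a * b = 0) : a ∈ m ^ n ∨ b ∈ m ^ n := by
    let N := n + n
    have hle : I ^ N ≤ I ^ 2 := Ideal.pow_le_pow_right (by omega)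
    let π : MvPolynomial σ K ⧸ I ^ N →ₐ[K] MvPolynomial σ K ⧸ I ^ 2 :=
      Ideal.Quotient.factorₐ K hle
    have hπ : Function.Surjective π := Ideal.Quotient.factor_surjective hle
    have hπk : IsNilpotent
        (RingHom.ker (π : MvPolynomial σ K ⧸ I ^ N →+* MvPolynomial σ K ⧸ I ^ 2)) := by
      refine ⟨N, ?_⟩
      have : RingHom.ker (π : MvPolynomial σ K ⧸ I ^ N →+* MvPolynomial σ K ⧸ I ^ 2) ≤
          I.map (Ideal.Quotient.mk (I ^ N)) := by
        intro y hy
        obtain ⟨p, rfl⟩ := Ideal.Quotient.mk_surjective y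
        have hp : p ∈ I ^ 2 := Ideal.Quotient.eq_zero_iff_mem.mp hy
        exact Ideal.mem_map_of_mem _ (Ideal.pow_le_self two_ne_zero hp)
      refine le_bot_iff.mp ((Ideal.pow_right_mono this N).trans ?_)
      rw [← Ideal.map_pow, Ideal.map_quotient_self]
    let φ := Algebra.FormallySmooth.liftOfSurjective g π hπ hπk
    have hφ (x : B) : π (φ x) = g x :=
      Algebra.FormallySmooth.liftOfSurjective_apply g π hπ hπk x
    let J := I.map (Ideal.Quotient.mk (I ^ N))
    have hJN : J ^ N = ⊥ := by rw [← Ideal.map_pow, Ideal.map_quotient_self]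
    have hφm : m ≤ J.comap φ := by
      intro x hx
      obtain ⟨p, hp, hp'⟩ := h2 x hx
      obtain ⟨y, hy⟩ := Ideal.Quotient.mk_surjective (φ x)
      have hgx : g x = Ideal.Quotient.mk _ p := by
        rw [← hg, ← sub_eq_zero, ← map_sub]
        simp only [g, AlgHom.comp_apply, AlgEquiv.toAlgHom_apply]
        rw [Ideal.Quotient.mkₐ_eq_mk, Ideal.Quotient.eq_zero_iff_mem.mpr hp', map_zero]
      have hyp : y - p ∈ I ^ 2 := by
        rw [← Ideal.Quotient.eq, ← hgx, ← hφ, ← hy]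
        rfl
      rw [Ideal.mem_comap, ← hy]
      refine Ideal.mem_map_of_mem _ ?_
      simpa using add_mem (Ideal.pow_le_self two_ne_zero hyp) hp
    have hφN : ∀ x ∈ m ^ N, φ x = 0 := by
      intro x hx
      have := Ideal.pow_right_mono (Ideal.map_le_iff_le_comap.mpr hφm) N
      rw [← Ideal.map_pow, hJN] at this
      exact this (Ideal.mem_map_of_mem _ hx)
    choose y hy using fun i ↦ Ideal.Quotient.mk_surjective (φ (h (X i)))
    let e : MvPolynomial σ K →ₐ[K] MvPolynomial σ K := aeval y
    have he (p) : Ideal.Quotient.mk (I ^ N) (e p) = φ (h p) := by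
      have : (Ideal.Quotient.mkₐ K (I ^ N)).comp e = φ.comp h :=
        MvPolynomial.algHom_ext fun i ↦ by simpa [e] using hy i
      exact DFunLike.congr_fun this p
    have he2 (p) : e p - p ∈ I ^ 2 := by
      have : π (Ideal.Quotient.mk (I ^ N) (e p)) = Ideal.Quotient.mk _ (e p) := rfl
      rw [← Ideal.Quotient.eq, ← this, he, hφ, hg]
    have heI : ∀ p ∈ I, e p ∈ I := fun p hp ↦ by
      simpa using add_mem (Ideal.pow_le_self two_ne_zero (he2 p)) hp
    have hediff (i : ℕ) : ∀ p ∈ I ^ i, e p - p ∈ I ^ (i + 1) := by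
      induction i with
      | zero => exact fun p _ ↦ Ideal.pow_le_pow_right one_le_two (he2 p)
      | succ i ih =>
        intro p hp
        rw [pow_succ] at hp
        induction hp using Submodule.mul_induction_on' with
        | mem_mul_mem p hp q hq =>
          have : e (p * q) - p * q = (e p - p) * e q + p * (e q - q) := by
            rw [map_mul]; ring
          rw [this]
          refine add_mem ?_ ?_
          · rw [pow_succ]
            exact Ideal.mul_mem_mul (ih p hp) (heI q hq)
          · rw [add_assoc, pow_add]
            exact Ideal.mul_mem_mul hp (he2 q)
        | add p _ q _ hp hq => simpa [add_sub_add_comm] using add_mem hp hq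
    have heinj (p) (hp : e p ∈ I ^ n) : p ∈ I ^ n := by
      have (i : ℕ) (hi : i ≤ n) : p ∈ I ^ i := by
        induction i with
        | zero => simp
        | succ i ih =>
          have := sub_mem (Ideal.pow_le_pow_right hi hp) (hediff i p (ih (by omega)))
          rwa [sub_sub_cancel] at this
      exact this n le_rfl
    have hmem (a p) (hp : a - h p ∈ m ^ N) (hep : e p ∈ I ^ n) : a ∈ m ^ n := by
      simpa using add_mem (Ideal.pow_le_pow_right (by omega : n ≤ N) hp) (hpow n p (heinj p hep))
    obtain ⟨p, hp⟩ := happ N a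
    obtain ⟨q, hq⟩ := happ N b
    have hpq : e p * e q ∈ I ^ N := by
      have hp' := hφN _ hp
      have hq' := hφN _ hq
      rw [map_sub, sub_eq_zero] at hp' hq'
      rw [← Ideal.Quotient.eq_zero_iff_mem, map_mul, he, he, ← hp', ← hq', ← map_mul, hab, map_zero]
    exact (mem_pow_idealOfVars_or_mem_of_mul_mem hpq).imp (hmem a p hp) (hmem b q hq)
  have hsep (a : B) (ha : a ≠ 0) : ∃ n, a ∉ m ^ n := by
    by_contra! hall
    exact ha (by simpa [hε] using (Ideal.mem_iInf (I := fun n ↦ m ^ n)).mpr hall)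
  have : NoZeroDivisors B := ⟨fun {a b} hab ↦ by
    by_contra! hne
    obtain ⟨r, hr⟩ := hsep a hne.1
    obtain ⟨s, hs⟩ := hsep b hne.2
    rcases main (r + s + 1) (by omega) a b hab with h | h
    · exact hr (Ideal.pow_le_pow_right (by omega) h)
    · exact hs (Ideal.pow_le_pow_right (by omega) h)⟩
  exact NoZeroDivisors.to_isDomain B
end Smooth

section BaseChange

variable {k A : Type u} [Field k] [CommRing A] [Algebra k A]

/-- The extension of scalars of a rational point of `Spec A`. -/
noncomputable def baseChangePoint (ε : A →ₐ[k] k) (S : Type u) [CommRing S] [Algebra k S] :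
    S ⊗[k] A →ₐ[S] S :=
  (Algebra.TensorProduct.rid k S S).toAlgHom.comp
    (Algebra.TensorProduct.map (AlgHom.id S S) ε)

@[simp]
theorem baseChangePoint_tmul (ε : A →ₐ[k] k) {S : Type u} [CommRing S] [Algebra k S]
    (s : S) (a : A) : baseChangePoint ε S (s ⊗ₜ a) = ε a • s := by
  simp [baseChangePoint]

/-- Change of coefficients. -/
noncomputable abbrev mapCoeff (A : Type u) [CommRing A] [Algebra k A] {S S' : Type u} [CommRing S]
    [CommRing S'] [Algebra k S] [Algebra k S'] (φ : S →ₐ[k] S') : S ⊗[k] A →ₐ[k] S' ⊗[k] A :=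
  Algebra.TensorProduct.map φ (AlgHom.id k A)

theorem baseChangePoint_mapCoeff (ε : A →ₐ[k] k) {S S' : Type u} [CommRing S] [CommRing S']
    [Algebra k S] [Algebra k S'] (φ : S →ₐ[k] S') (x : S ⊗[k] A) :
    baseChangePoint ε S' (mapCoeff A φ x) = φ (baseChangePoint ε S x) := by
  induction x with
  | zero => simp
  | tmul s a => simp
  | add x y hx hy => simp only [map_add, hx, hy]

theorem basis_repr_mapCoeff {ι : Type u} (b : Module.Basis ι k A) {S S' : Type u} [CommRing S]
    [CommRing S'] [Algebra k S] [Algebra k S'] (φ : S →ₐ[k] S') (x : S ⊗[k] A) (i : ι) :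
    (Algebra.TensorProduct.basis S' b).repr (mapCoeff A φ x) i =
      φ ((Algebra.TensorProduct.basis S b).repr x i) := by
  induction x with
  | zero => simp
  | tmul s a => simp
  | add x y hx hy => simp only [map_add, Finsupp.add_apply, hx, hy]

theorem mapCoeff_injective {S S' : Type u} [CommRing S]
    [CommRing S'] [Algebra k S] [Algebra k S'] (φ : S →ₐ[k] S') (hφ : Function.Injective φ) :
    Function.Injective (mapCoeff A φ) := by
  intro x y h
  refine (Algebra.TensorProduct.basis S (Module.Basis.ofVectorSpace k A)).repr.injective
    (Finsupp.ext fun i ↦ hφ ?_)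
  rw [← basis_repr_mapCoeff, ← basis_repr_mapCoeff, h]

theorem ker_baseChangePoint (ε : A →ₐ[k] k) (F : Type u) [Field F] [Algebra k F] :
    RingHom.ker (baseChangePoint ε F) =
      (RingHom.ker ε).map (Algebra.TensorProduct.includeRight : A →ₐ[k] F ⊗[k] A) := by
  have hε : Function.Surjective ε := fun c ↦ ⟨algebraMap k A c, by simp⟩
  rw [← Algebra.TensorProduct.lTensor_ker ε hε]
  ext x
  simp only [baseChangePoint, RingHom.mem_ker, AlgHom.comp_apply, AlgEquiv.toAlgHom_apply,
    EmbeddingLike.map_eq_zero_iff]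
  rfl

/-- A domain which is noetherian and formally smooth over `k` and has a rational point stays a
domain after any extension of the base field. -/
theorem isDomain_baseChange [IsDomain A] [IsNoetherianRing A] [Algebra.FormallySmooth k A]
    (ε : A →ₐ[k] k) (F : Type u) [Field F] [Algebra k F] : IsDomain (F ⊗[k] A) := by
  refine isDomain_of_formallySmooth_of_iInf_pow_eq_bot (baseChangePoint ε F) ?_
  rw [eq_bot_iff]
  intro x hx
  rw [Ideal.mem_iInf] at hx
  classical
  let b := Module.Basis.ofVectorSpace k F
  refine (TensorProduct.equivFinsuppOfBasisLeft (N := A) b).injective (Finsupp.ext fun i ↦ ?_)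
  rw [map_zero, Finsupp.zero_apply, TensorProduct.equivFinsuppOfBasisLeft_apply]
  set y := TensorProduct.lid k A ((b.coord i).rTensor A x) with hy
  have hbot : y ∈ ⨅ n : ℕ, RingHom.ker ε ^ n := by
    rw [Ideal.mem_iInf]
    intro n
    have hn := hx n
    rw [ker_baseChangePoint, ← Ideal.map_pow] at hn
    have hn' : x ∈ ((RingHom.ker ε ^ n).map
        (Algebra.TensorProduct.includeRight : A →ₐ[k] F ⊗[k] A)).restrictScalars k := hn
    rw [Ideal.map_includeRight_eq] at hn'
    obtain ⟨z, rfl⟩ := hn'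
    rw [hy]
    clear hy hn hx
    induction z with
    | zero => simp
    | tmul s a => simpa using Submodule.smul_of_tower_mem _ _ a.2
    | add z w hz hw => simpa only [map_add] using add_mem hz hw
  rwa [Ideal.iInf_pow_eq_bot_of_isDomain _ (RingHom.ker_ne_top ε)] at hbot

end BaseChange

section Valuation

variable {k A : Type u} [Field k] [CommRing A] [Algebra k A]

theorem ValuationSubring.exists_primitive {L : Type u} [Field L] [Algebra k L]
    (V : ValuationSubring L) [Algebra k V] [IsScalarTower k V L] {x : L ⊗[k] A} (hx : x ≠ 0) :
    ∃ c : L, c ≠ 0 ∧ ∃ y : V ⊗[k] A, x = c • mapCoeff A (IsScalarTower.toAlgHom k V L) y ∧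
      mapCoeff A (IsScalarTower.toAlgHom k V (IsLocalRing.ResidueField V)) y ≠ 0 := by
  let b := Module.Basis.ofVectorSpace k A
  let bL := Algebra.TensorProduct.basis L b
  let bV := Algebra.TensorProduct.basis V b
  have hne : (bL.repr x).support.Nonempty := by
    rw [Finsupp.support_nonempty_iff]
    simpa using hx
  obtain ⟨i, hi, hmax⟩ := Finset.exists_max_image _ (fun j ↦ V.valuation (bL.repr x j)) hne
  have hc : bL.repr x i ≠ 0 := Finsupp.mem_support_iff.mp hi
  set c := bL.repr x i with hcdef
  have hmem (j) : c⁻¹ * bL.repr x j ∈ V := by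
    rw [← V.valuation_le_one_iff, map_mul, map_inv₀]
    by_cases hj : j ∈ (bL.repr x).support
    · rw [mul_comm]
      exact mul_inv_le_one_of_le₀ (hmax j hj) zero_le
    · simp [Finsupp.notMem_support_iff.mp hj]
  let y : V ⊗[k] A := bV.repr.symm (Finsupp.onFinset (bL.repr x).support
    (fun j ↦ ⟨c⁻¹ * bL.repr x j, hmem j⟩) fun j hj ↦ by
      rw [Finsupp.mem_support_iff]
      rintro h0
      exact hj (Subtype.ext (by simp [h0])))
  have hy (j) : bV.repr y j = ⟨c⁻¹ * bL.repr x j, hmem j⟩ := by simp [y]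
  refine ⟨c, hc, y, bL.repr.injective (Finsupp.ext fun j ↦ ?_), fun h0 ↦ ?_⟩
  · rw [map_smul, Finsupp.smul_apply, basis_repr_mapCoeff, hy]
    simp [ValuationSubring.algebraMap_apply, mul_inv_cancel_left₀ hc]
  · have := basis_repr_mapCoeff b (IsScalarTower.toAlgHom k V (IsLocalRing.ResidueField V)) y i
    rw [h0, hy] at this
    have h1 : (⟨c⁻¹ * bL.repr x i, hmem i⟩ : V) = 1 :=
      Subtype.ext (by simp [← hcdef, inv_mul_cancel₀ hc])
    rw [h1] at this
    simp at this

/-- A unit of `L ⊗ A` which is `1` at a rational point of `Spec A` has coordinates in every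
valuation ring of `L` over `k`. -/
theorem ValuationSubring.basis_repr_mem_of_isUnit {L : Type u} [Field L] [Algebra k L]
    (V : ValuationSubring L) [Algebra k V] [IsScalarTower k V L]
    [IsDomain (IsLocalRing.ResidueField V ⊗[k] A)]
    (ε : A →ₐ[k] k) {f : L ⊗[k] A} (hf : IsUnit f) (hf1 : baseChangePoint ε L f = 1)
    {ι : Type u} (b : Module.Basis ι k A) (i : ι) :
    (Algebra.TensorProduct.basis L b).repr f i ∈ V := by
  have : Nontrivial (L ⊗[k] A) := (baseChangePoint ε L).toRingHom.domain_nontrivial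
  set j := IsScalarTower.toAlgHom k V L
  set r := IsScalarTower.toAlgHom k V (IsLocalRing.ResidueField V)
  have hj : Function.Injective j := Subtype.val_injective
  obtain ⟨g, hfg⟩ := hf.exists_right_inv
  have hg1 : baseChangePoint ε L g = 1 := by
    simpa [hf1] using congrArg (baseChangePoint ε L) hfg
  obtain ⟨c, hc, x, rfl, hx⟩ := V.exists_primitive hf.ne_zero
  obtain ⟨d, hd, y, rfl, hy⟩ := V.exists_primitive (right_ne_zero_of_mul_eq_one hfg)
  rw [map_smul, baseChangePoint_mapCoeff, smul_eq_mul] at hf1 hg1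
  have hxy : x * y = algebraMap V (V ⊗[k] A) (baseChangePoint ε V (x * y)) := by
    apply mapCoeff_injective j hj
    have : mapCoeff A j (x * y) = (c * d)⁻¹ • 1 := by
      rw [← hfg, smul_mul_smul_comm, smul_smul, inv_mul_cancel₀ (mul_ne_zero hc hd), one_smul,
        map_mul]
    have h2 : j (baseChangePoint ε V (x * y)) = (c * d)⁻¹ := by
      rw [← baseChangePoint_mapCoeff, this]; simp
    rw [Algebra.TensorProduct.algebraMap_apply, mapCoeff, Algebra.TensorProduct.map_tmul,
      Algebra.algebraMap_self_apply, h2, ← mapCoeff, this, Algebra.TensorProduct.one_def,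
      TensorProduct.smul_tmul']
    simp
  have hu : IsUnit (baseChangePoint ε V (x * y)) := by
    by_contra hnu
    have h0 : r (baseChangePoint ε V (x * y)) = 0 := (IsLocalRing.residue_eq_zero_iff _).mpr hnu
    have := congrArg (mapCoeff A r) hxy
    rw [map_mul, Algebra.TensorProduct.algebraMap_apply, mapCoeff, Algebra.TensorProduct.map_tmul,
      Algebra.algebraMap_self_apply, h0, zero_tmul] at this
    exact mul_ne_zero hx hy this
  rw [map_mul] at hu
  obtain ⟨u, hu'⟩ := isUnit_of_mul_isUnit_left hu
  have hcV : c ∈ V := by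
    have h3 : c = j (u⁻¹ : Vˣ) := by
      rw [← hu'] at hf1
      have h4 : j (u : V) * j (u⁻¹ : Vˣ) = 1 := by rw [← map_mul, Units.mul_inv, map_one]
      calc c = c * j u * j (u⁻¹ : Vˣ) := by rw [mul_assoc, h4, mul_one]
        _ = _ := by rw [hf1, one_mul]
    rw [h3]
    exact (u⁻¹ : Vˣ).1.2
  rw [map_smul, Finsupp.smul_apply, basis_repr_mapCoeff]
  exact V.mul_mem _ _ hcV (Subtype.mem _)

end Valuation

section Units

variable {k A : Type u} [Field k] [CommRing A] [Algebra k A]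

theorem IsIntegral.eq_algebraMap_of_point {K T : Type u} [Field K] [CommRing T] [IsDomain T]
    [Algebra K T] (e : T →ₐ[K] K) {t : T} (ht : IsIntegral K t) : t = algebraMap K T (e t) := by
  by_contra hne
  have hu : IsUnit (t - algebraMap K T (e t)) :=
    (ht.sub isIntegral_algebraMap).isUnit (sub_ne_zero.mpr hne)
  have := hu.map e
  simp at this

theorem isIntegral_of_forall_mem_valuationSubring {K L : Type u} [Field K] [Field L] [Algebra K L]
    {x : L} (h : ∀ V : ValuationSubring L, (∀ c : K, algebraMap K L c ∈ V) → x ∈ V) :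
    IsIntegral K x := by
  let R := (integralClosure K L).toSubring
  have : IsIntegrallyClosedIn R L := inferInstanceAs (IsIntegrallyClosedIn (integralClosure K L) L)
  change x ∈ R
  rw [Subring.eq_iInf_of_isIntegrallyClosedIn (R := R), Subring.mem_iInf]
  exact fun V ↦ h V.1 fun c ↦ V.2 (algebraMap_mem (integralClosure K L) c)

/-- A unit on a product of a variety `T` over `K` with a geometrically integral variety `Spec A`
over `k`, equal to `1` on the fibres over a rational point of each factor, is `1`. -/
theorem eq_one_of_isUnit_of_eq_one_on_fibres
    (hA : ∀ (F : Type u) [Field F] [Algebra k F], IsDomain (F ⊗[k] A)) (ε : A →ₐ[k] k)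
    {K T : Type u} [Field K] [Algebra k K] [CommRing T] [IsDomain T] [Algebra K T] [Algebra k T]
    [IsScalarTower k K T] (e : T →ₐ[K] K) {f : T ⊗[k] A} (hf : IsUnit f)
    (h1 : baseChangePoint ε T f = 1) (h2 : mapCoeff A (e.restrictScalars k) f = 1) : f = 1 := by
  let L := FractionRing T
  let b := Module.Basis.ofVectorSpace k A
  let bT := Algebra.TensorProduct.basis T b
  have hint (i) : IsIntegral K (bT.repr f i) := by
    rw [← isIntegral_algebraMap_iff (IsFractionRing.injective T L)]
    refine isIntegral_of_forall_mem_valuationSubring fun V hV ↦ ?_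
    have hk (c : k) : algebraMap k L c ∈ V := by
      rw [IsScalarTower.algebraMap_apply k K L]
      exact hV _
    let : Algebra k V := ((algebraMap k L).codRestrict V.toSubring hk).toAlgebra
    have : IsScalarTower k V L := IsScalarTower.of_algebraMap_eq fun c ↦ rfl
    have := hA (IsLocalRing.ResidueField V)
    have hmem := V.basis_repr_mem_of_isUnit ε (hf.map (mapCoeff A (IsScalarTower.toAlgHom k T L)))
      (by rw [baseChangePoint_mapCoeff, h1, map_one]) b i
    rwa [basis_repr_mapCoeff] at hmem
  have key : mapCoeff A (IsScalarTower.toAlgHom k K T) (mapCoeff A (e.restrictScalars k) f) = f := by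
    refine bT.repr.injective (Finsupp.ext fun i ↦ ?_)
    rw [basis_repr_mapCoeff, basis_repr_mapCoeff]
    exact ((hint i).eq_algebraMap_of_point e).symm
  rw [← key, h2, map_one]

theorem eq_zero_of_mapCoeff_residueField_eq_zero {R : Type u} [CommRing R] [Algebra k R]
    [IsReduced R] {x : (R ⊗[k] A) ⊗[k] A}
    (h : ∀ (p : Ideal R) [p.IsPrime],
      mapCoeff A (mapCoeff A (IsScalarTower.toAlgHom k R p.ResidueField)) x = 0) : x = 0 := by
  let b := Module.Basis.ofVectorSpace k A
  refine (Algebra.TensorProduct.basis (R ⊗[k] A) b).repr.injective (Finsupp.ext fun i ↦ ?_)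
  refine (Algebra.TensorProduct.basis R b).repr.injective (Finsupp.ext fun j ↦ ?_)
  simp only [map_zero, Finsupp.zero_apply]
  refine IsNilpotent.eq_zero ?_
  rw [← mem_nilradical, nilradical_eq_sInf, Ideal.mem_sInf]
  intro p hp
  have : p.IsPrime := hp
  rw [← Ideal.algebraMap_residueField_eq_zero]
  change IsScalarTower.toAlgHom k R p.ResidueField _ = 0
  rw [← basis_repr_mapCoeff, ← basis_repr_mapCoeff, h p]
  simp

end Units

/-- Let `G = Spec A` be a connected (smooth affine) algebraic group and
`X = Spec R` a reduced scheme over `k`.  If `f` is a unit on `G × G × X` (i.e. a unit of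
`A ⊗ A ⊗ R`) such that `f(e_G, g, x) = 1 = f(g, e_G, x)` identically (its images under
evaluation of either `G`-factor at the identity are `1`), then `f = 1`. -/
theorem unit_on_double_group_eq_one
    (k : Type u) [Field k] (A : Type u) [CommRing A] [HopfAlgebra k A]
    [IsDomain A] (hfg : Algebra.FiniteType k A) (hsm : Algebra.FormallySmooth k A)
    (R : Type u) [CommRing R] [Algebra k R] [IsReduced R]
    (f : (A ⊗[k] (A ⊗[k] R))ˣ)
    (h1 : Units.map (evalAtIdentity k A (A ⊗[k] R)).toRingHom.toMonoidHom f = 1)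
    (h2 : Units.map (Algebra.TensorProduct.map (AlgHom.id k A)
        (evalAtIdentity k A R)).toRingHom.toMonoidHom f = 1) :
    f = 1 := by
  let ε : A →ₐ[k] k := Bialgebra.counitAlgHom k A
  have : IsNoetherianRing A := Algebra.FiniteType.isNoetherianRing k A
  have hA (F : Type u) [Field F] [Algebra k F] : IsDomain (F ⊗[k] A) := isDomain_baseChange ε F
  replace h1 : evalAtIdentity k A (A ⊗[k] R) f = 1 := congrArg Units.val h1
  replace h2 : Algebra.TensorProduct.map (AlgHom.id k A) (evalAtIdentity k A R)
      (f : A ⊗[k] (A ⊗[k] R)) = 1 :=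
    congrArg Units.val h2
  let s : A ⊗[k] R ≃ₐ[k] R ⊗[k] A := Algebra.TensorProduct.comm k A R
  let Θ : A ⊗[k] (A ⊗[k] R) ≃ₐ[k] (R ⊗[k] A) ⊗[k] A :=
    (Algebra.TensorProduct.comm k A (A ⊗[k] R)).trans
      (Algebra.TensorProduct.congr s AlgEquiv.refl)
  have hΘ : Θ f - 1 = 0 := by
    refine eq_zero_of_mapCoeff_residueField_eq_zero fun p _ ↦ ?_
    let K := p.ResidueField
    let φ := IsScalarTower.toAlgHom k R K
    have := hA K
    rw [map_sub, map_one, sub_eq_zero]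
    refine eq_one_of_isUnit_of_eq_one_on_fibres hA ε (baseChangePoint ε K)
      ((f.isUnit.map Θ).map (mapCoeff A (mapCoeff A φ))) ?_ ?_
    · have : ((baseChangePoint ε (K ⊗[k] A)).restrictScalars k).comp
          ((mapCoeff A (mapCoeff A φ)).comp Θ.toAlgHom) =
          ((mapCoeff A φ).comp s.toAlgHom).comp (evalAtIdentity k A (A ⊗[k] R)) := by
        ext <;> simp [Θ, s, evalAtIdentity, ε]
      simpa [h1] using DFunLike.congr_fun this (f : A ⊗[k] (A ⊗[k] R))
    · have : (mapCoeff A ((baseChangePoint ε K).restrictScalars k)).comp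
          ((mapCoeff A (mapCoeff A φ)).comp Θ.toAlgHom) =
          ((mapCoeff A φ).comp s.toAlgHom).comp
            (Algebra.TensorProduct.map (AlgHom.id k A) (evalAtIdentity k A R)) := by
        ext <;> simp [Θ, s, evalAtIdentity, ε, TensorProduct.smul_tmul']
      simpa [h2] using DFunLike.congr_fun this (f : A ⊗[k] (A ⊗[k] R))
  exact Units.ext (Θ.injective (by rw [Units.val_one, map_one, ← sub_eq_zero, hΘ]))
end

section
/- Let A be a henselian local ring whose spectrum is seminormal, and T = G_m^n a split torus. Then Pic(A[t_1,...,t_n, t_1^{-1},...,t_n^{-1}]) = 0. -/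
open TensorProduct

universe u

/-- A commutative ring is seminormal (Traverso–Swan): it is reduced and whenever
`b ^ 3 = c ^ 2` there is an element `a` with `a ^ 2 = b` and `a ^ 3 = c`. -/
def IsSeminormalRing (R : Type*) [CommRing R] : Prop :=
  IsReduced R ∧ ∀ b c : R, b ^ 3 = c ^ 2 → ∃ a : R, a ^ 2 = b ∧ a ^ 3 = c

/-- An `R`-module is invertible (a line bundle on `Spec R`). -/
def IsInvertibleModule (R : Type u) [CommRing R] (M : Type u) [AddCommGroup M]
    [Module R M] : Prop :=
  ∃ (N : Type u) (_ : AddCommGroup N) (_ : Module R N), Nonempty ((M ⊗[R] N) ≃ₗ[R] R)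

section

open Polynomial IsLocalRing

/-- A point of an étale algebra over a henselian local ring with values in the residue field
lifts to a point with values in the ring. -/
theorem HenselianLocalRing.exists_algHom_of_etale {A : Type*} [CommRing A] [HenselianLocalRing A]
    {R : Type*} [CommRing R] [Algebra A R] [Algebra.Etale A R]
    (φ : R →ₐ[A] ResidueField A) :
    ∃ s : R →ₐ[A] A, ∀ x, residue A (s x) = φ x := by
  let Q : Ideal R := RingHom.ker φ
  have hprime : Q.IsPrime := RingHom.ker_isPrime _
  have hfp : Algebra.FinitePresentation A R := inferInstance
  obtain ⟨f, hf, hstd⟩ :=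
    Algebra.IsEtaleAt.exists_isStandardEtale (R := A) Q
  obtain ⟨P⟩ : Nonempty (StandardEtalePresentation A (Localization.Away f)) :=
    Algebra.IsStandardEtale.nonempty_standardEtalePresentation
  have hfu : IsUnit (φ f) := (show φ f ≠ 0 from hf).isUnit
  let ψ : Localization.Away f →ₐ[A] ResidueField A :=
    IsLocalization.Away.liftAlgHom f (f := φ) hfu
  have hψ (x : R) : ψ (algebraMap R _ x) = φ x := by
    simp [ψ]
  have hmap := P.hasMap.map ψ
  have hens := ((HenselianLocalRing.TFAE A).out 0 1).mp ‹HenselianLocalRing A›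
  obtain ⟨a, ha, ha'⟩ := hens P.f P.monic_f (ψ P.x) hmap.1 hmap.isUnit_derivative_f.ne_zero
  have haMap : P.HasMap a := by
    refine ⟨by simpa [aeval_def, IsRoot] using ha, ?_⟩
    have : residue A (aeval a P.g) = aeval (ψ P.x) P.g := by
      rw [← ha', ← ResidueField.algebraMap_eq, aeval_algebraMap_apply]
    rw [← isUnit_map_iff (residue A), this]
    exact hmap.2
  let t : Localization.Away f →ₐ[A] A := (P.lift a haMap).comp P.equivRing.toAlgHom
  have ht : (IsScalarTower.toAlgHom A A (ResidueField A)).comp t = ψ := by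
    refine P.hom_ext ?_
    simpa [t] using ha'
  refine ⟨t.comp (IsScalarTower.toAlgHom A R _), fun x ↦ ?_⟩
  rw [← hψ, ← ht]
  rfl

/-- Coprime factorizations of monic polynomials lift over a henselian local ring. -/
theorem HenselianLocalRing.exists_factorization {A : Type*} [CommRing A] [HenselianLocalRing A]
    (p : A[X]) (hp : p.Monic) (f g : (ResidueField A)[X]) (hf : f.Monic) (hg : g.Monic)
    (h : p.map (residue A) = f * g) (hfg : IsCoprime f g) :
    ∃ f' g' : A[X], f'.Monic ∧ g'.Monic ∧ p = f' * g' ∧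
      f'.map (residue A) = f ∧ g'.map (residue A) = g := by
  have hn : p.natDegree = f.natDegree + g.natDegree := by
    rw [← hf.natDegree_mul hg, ← h, hp.natDegree_map]
  let e (S : Type _) [CommRing S] [Algebra A S] :=
    UniversalCoprimeFactorizationRing.homEquiv S f.natDegree g.natDegree hn (.mk p hp rfl)
  let φ := (e (ResidueField A)).symm ⟨(.mk f hf rfl, .mk g hg rfl), h.symm, hfg⟩
  obtain ⟨s, hs⟩ := HenselianLocalRing.exists_algHom_of_etale φ
  have hs' : (IsScalarTower.toAlgHom A A (ResidueField A)).comp s = φ := AlgHom.ext hs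
  have h1 := UniversalCoprimeFactorizationRing.homEquiv_comp_fst A f.natDegree g.natDegree hn
    (.mk p hp rfl) s (IsScalarTower.toAlgHom A A (ResidueField A))
  have h2 := UniversalCoprimeFactorizationRing.homEquiv_comp_snd A f.natDegree g.natDegree hn
    (.mk p hp rfl) s (IsScalarTower.toAlgHom A A (ResidueField A))
  rw [hs'] at h1 h2
  have h3 := (e (ResidueField A)).apply_symm_apply
    ⟨(.mk f hf rfl, .mk g hg rfl), h.symm, hfg⟩
  refine ⟨(e A s).1.1.1, (e A s).1.2.1, (e A s).1.1.monic, (e A s).1.2.monic, ?_, ?_, ?_⟩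
  · simpa using (e A s).2.1.symm
  · exact (congr_arg Subtype.val h1).symm.trans (congr_arg (fun q ↦ q.1.1.1) h3)
  · exact (congr_arg Subtype.val h2).symm.trans (congr_arg (fun q ↦ q.1.2.1) h3)

/-- Over a henselian local ring, every monic polynomial is the product of a monic polynomial
reducing to a power of `X` and a polynomial with invertible constant coefficient. -/
theorem HenselianLocalRing.exists_eq_mul_of_monic {A : Type*} [CommRing A] [HenselianLocalRing A]
    (p : A[X]) (hp : p.Monic) :
    ∃ (f g : A[X]) (n : ℕ), f.Monic ∧ p = f * g ∧ f.map (residue A) = X ^ n ∧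
      IsUnit (g.coeff 0) := by
  have hp0 : p.map (residue A) ≠ 0 := (hp.map _).ne_zero
  obtain ⟨q, hq, hq'⟩ := exists_eq_pow_rootMultiplicity_mul_and_not_dvd _ hp0 0
  set n := rootMultiplicity 0 (p.map (residue A))
  simp only [map_zero, sub_zero] at hq hq'
  have hqm : q.Monic := (monic_X_pow n).of_mul_monic_left (hq ▸ hp.map _)
  have hcop : IsCoprime (X ^ n) q :=
    IsCoprime.pow_left ((irreducible_X.coprime_iff_not_dvd).2 hq')
  obtain ⟨f, g, hf, -, hfg, hf', hg'⟩ :=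
    HenselianLocalRing.exists_factorization p hp _ q (monic_X_pow n) hqm hq hcop
  refine ⟨f, g, n, hf, hfg, hf', ?_⟩
  rw [← isUnit_map_iff (residue A), ← coeff_map, hg']
  exact isUnit_iff_ne_zero.2 fun h ↦ hq' (X_dvd_iff.2 h)

end

section

open Polynomial IsLocalRing

/-- An element of an algebra over a local ring `A` is residually nilpotent if it is a root of a
monic polynomial whose reduction to the residue field is a power of `X`. -/
def IsResiduallyNilpotent (A : Type*) [CommRing A] [IsLocalRing A] {R : Type*} [CommRing R]
    [Algebra A R] (x : R) : Prop :=
  ∃ (h : A[X]) (n : ℕ), h.Monic ∧ h.map (residue A) = X ^ n ∧ aeval x h = 0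

theorem notMem_of_aeval_eq_zero {A R : Type*} [CommRing A] [CommRing R] [Algebra A R] {x : R}
    {g : A[X]} (hg : IsUnit (g.coeff 0)) (hx : aeval x g = 0) (I : Ideal R) (hI : I ≠ ⊤) :
    x ∉ I := by
  intro hxI
  have h1 : algebraMap A R (g.coeff 0) ∈ I := by
    have h2 : aeval x (C (g.coeff 0)) + aeval x (X * g.divX) = 0 := by
      rw [← map_add, add_comm, X_mul_divX_add, hx]
    have h3 : algebraMap A R (g.coeff 0) = - (x * aeval x g.divX) := by
      simpa [eq_neg_iff_add_eq_zero] using h2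
    rw [h3]
    exact I.neg_mem (I.mul_mem_right _ hxI)
  exact hI (Ideal.eq_top_of_isUnit_mem _ h1 (hg.map _))

section

variable {A : Type*} [CommRing A] [IsLocalRing A] {R S : Type*} [CommRing R] [CommRing S]
  [Algebra A R] [Algebra A S]

theorem IsResiduallyNilpotent.isIntegral {x : R} (hx : IsResiduallyNilpotent A x) :
    IsIntegral A x := by
  obtain ⟨h, -, hm, -, h0⟩ := hx
  exact ⟨h, hm, h0⟩

theorem IsResiduallyNilpotent.map {x : R} (hx : IsResiduallyNilpotent A x) (φ : R →ₐ[A] S) :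
    IsResiduallyNilpotent A (φ x) := by
  obtain ⟨h, n, hm, hn, h0⟩ := hx
  exact ⟨h, n, hm, hn, by rw [aeval_algHom_apply, h0, map_zero]⟩

theorem isResiduallyNilpotent_map_iff {x : R} (φ : R →ₐ[A] S) (hφ : Function.Injective φ) :
    IsResiduallyNilpotent A (φ x) ↔ IsResiduallyNilpotent A x := by
  refine ⟨?_, fun h ↦ h.map φ⟩
  rintro ⟨h, n, hm, hn, h0⟩
  exact ⟨h, n, hm, hn, hφ (by rw [← aeval_algHom_apply, h0, map_zero])⟩

theorem isResiduallyNilpotent_zero : IsResiduallyNilpotent A (0 : R) :=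
  ⟨X, 1, monic_X, by simp, by simp⟩

theorem IsResiduallyNilpotent.mem {x : R} (hx : IsResiduallyNilpotent A x) (I : Ideal R)
    [I.IsPrime] (hI : maximalIdeal A ≤ I.comap (algebraMap A R)) : x ∈ I := by
  obtain ⟨h, n, -, hn, h0⟩ := hx
  have key : h - X ^ n ∈ (maximalIdeal A).map (C : A →+* A[X]) := by
    rw [Ideal.mem_map_C_iff]
    intro k
    rw [← residue_eq_zero_iff, ← coeff_map]
    simp [hn]
  have h2 : aeval x (h - X ^ n) ∈ I := by
    have : (maximalIdeal A).map (C : A →+* A[X]) ≤ I.comap (aeval (R := A) x) := by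
      rw [Ideal.map_le_iff_le_comap]
      intro a ha
      simpa using hI ha
    exact this key
  rw [map_sub, h0, zero_sub, neg_mem_iff] at h2
  exact Ideal.IsPrime.mem_of_pow_mem ‹_› n (by simpa using h2)

theorem IsLocalRing.maximalIdeal_le_comap [Algebra.IsIntegral A R] (I : Ideal R) [I.IsMaximal] :
    maximalIdeal A ≤ I.comap (algebraMap A R) := by
  have := Ideal.isMaximal_comap_of_isIntegral_of_isMaximal (R := A) I
  exact (IsLocalRing.eq_maximalIdeal this).ge

end

section

variable {A : Type*} [CommRing A] [HenselianLocalRing A] {R : Type*} [CommRing R]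
  [Algebra A R]

/-- An integral domain that is integral over a henselian local ring is local: its only maximal
ideal consists of the residually nilpotent elements. -/
theorem mem_maximal_iff_isResiduallyNilpotent [IsDomain R] [Algebra.IsIntegral A R] (I : Ideal R)
    [I.IsMaximal] (x : R) : x ∈ I ↔ IsResiduallyNilpotent A x := by
  refine ⟨fun hx ↦ ?_, fun hx ↦ hx.mem I (IsLocalRing.maximalIdeal_le_comap I)⟩
  obtain ⟨p, hp, hpx⟩ := Algebra.IsIntegral.isIntegral (R := A) x
  obtain ⟨f, g, n, hf, rfl, hfn, hg⟩ := HenselianLocalRing.exists_eq_mul_of_monic p hp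
  change aeval x (f * g) = 0 at hpx
  rw [map_mul, mul_eq_zero] at hpx
  rcases hpx with h | h
  · exact ⟨f, n, hf, hfn, h⟩
  · exact absurd hx (notMem_of_aeval_eq_zero hg h I Ideal.IsPrime.ne_top')

/-- Residual nilpotence of integral elements of a product of domains can be tested on factors. -/
theorem isResiduallyNilpotent_pi {ι : Type*} {F : ι → Type*} [∀ i, CommRing (F i)]
    [∀ i, IsDomain (F i)] [∀ i, Algebra A (F i)] {x : ∀ i, F i} (hx : IsIntegral A x)
    (h : ∀ i, IsResiduallyNilpotent A (x i)) : IsResiduallyNilpotent A x := by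
  obtain ⟨p, hp, hpx⟩ := hx
  obtain ⟨f, g, n, hf, rfl, hfn, hg⟩ := HenselianLocalRing.exists_eq_mul_of_monic p hp
  change aeval x (f * g) = 0 at hpx
  refine ⟨f, n, hf, hfn, funext fun i ↦ ?_⟩
  have hev (q : A[X]) : aeval x q i = aeval (x i) q :=
    (aeval_algHom_apply (Pi.evalAlgHom A F i) x q).symm
  rw [hev, Pi.zero_apply]
  have h0 : aeval (x i) f * aeval (x i) g = 0 := by
    rw [← map_mul, ← hev, hpx, Pi.zero_apply]
  refine (mul_eq_zero.1 h0).resolve_right fun hgi ↦ ?_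
  let y : integralClosure A (F i) := ⟨x i, (h i).isIntegral⟩
  have hy : IsResiduallyNilpotent A y :=
    (isResiduallyNilpotent_map_iff (integralClosure A (F i)).val Subtype.val_injective).1 (h i)
  obtain ⟨I, hI⟩ := Ideal.exists_maximal (integralClosure A (F i))
  refine notMem_of_aeval_eq_zero (x := y) hg ?_ I hI.ne_top
    ((mem_maximal_iff_isResiduallyNilpotent I y).2 hy)
  apply Subtype.val_injective
  change (integralClosure A (F i)).val (aeval y g) = 0
  rw [← aeval_algHom_apply]
  exact hgi

end

end

namespace AddMonoidAlgebra

section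

variable {R S Γ : Type*} [CommRing R] [CommRing S] [AddCommGroup Γ]

/-- The augmentation (sum of coefficients) of an additive monoid algebra. -/
noncomputable def augmentation (R Γ : Type*) [CommRing R] [AddCommGroup Γ] :
    AddMonoidAlgebra R Γ →ₐ[R] R :=
  lift R R Γ 1

@[simp]
theorem augmentation_single (γ : Γ) (r : R) : augmentation R Γ (single γ r) = r := by
  simp [augmentation, lift_single]

theorem augmentation_mapRingHom (φ : R →+* S) (x : AddMonoidAlgebra R Γ) :
    augmentation S Γ (mapRingHom Γ φ x) = φ (augmentation R Γ x) := by
  have : ((augmentation S Γ : _ →+* S).comp (mapRingHom Γ φ)) =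
      φ.comp (augmentation R Γ : _ →+* R) := by
    ext <;> simp
  exact DFunLike.congr_fun this x

theorem exists_mapRingHom_eq (φ : R →+* S) (x : AddMonoidAlgebra S Γ)
    (h : ∀ γ, x.coeff γ ∈ Set.range φ) : ∃ y, mapRingHom Γ φ y = x := by
  choose c hc using h
  refine ⟨∑ γ ∈ x.coeff.support, single γ (c γ), ?_⟩
  simp_rw [map_sum, mapRingHom_single, hc]
  exact sum_coeff_single x

theorem exists_of_coeff_mul_ne_zero {x y : AddMonoidAlgebra R Γ} {γ : Γ}
    (h : (x * y).coeff γ ≠ 0) :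
    ∃ α β, x.coeff α ≠ 0 ∧ y.coeff β ≠ 0 ∧ α + β = γ := by
  classical
  have := support_coeff_mul_subset x y (Finsupp.mem_support_iff.2 h)
  obtain ⟨α, hα, β, hβ, e⟩ := Finset.mem_add.1 this
  exact ⟨α, β, Finsupp.mem_support_iff.1 hα, Finsupp.mem_support_iff.1 hβ, e⟩

/-- Degrees with respect to an additive functional `ℓ` are additive over a domain. -/
theorem exists_le_of_coeff_ne_zero [NoZeroDivisors (AddMonoidAlgebra R Γ)]
    (ℓ : Γ →+ ℤ) {x y : AddMonoidAlgebra R Γ} {α β : Γ} (hα : x.coeff α ≠ 0)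
    (hβ : y.coeff β ≠ 0) : ∃ γ, (x * y).coeff γ ≠ 0 ∧ ℓ α + ℓ β ≤ ℓ γ := by
  classical
  have top (z : AddMonoidAlgebra R Γ) (ζ : Γ) (hζ : z.coeff ζ ≠ 0) :
      ∃ (d : ℤ) (u v : AddMonoidAlgebra R Γ), ℓ ζ ≤ d ∧ u ≠ 0 ∧ u + v = z ∧
        (∀ γ, u.coeff γ ≠ 0 → ℓ γ = d) ∧ ∀ γ, v.coeff γ ≠ 0 → ℓ γ < d := by
    obtain ⟨η, hη, hmax⟩ := Finset.exists_max_image z.coeff.support ℓ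
      ⟨ζ, Finsupp.mem_support_iff.2 hζ⟩
    refine ⟨ℓ η, ofCoeff (z.coeff.filter fun γ ↦ ℓ γ = ℓ η),
      ofCoeff (z.coeff.filter fun γ ↦ ¬ ℓ γ = ℓ η), hmax ζ (Finsupp.mem_support_iff.2 hζ),
      fun h ↦ ?_, ?_, fun γ hγ ↦ ?_, fun γ hγ ↦ ?_⟩
    · have := congr_arg (fun w ↦ w.coeff η) h
      simp at this
      exact Finsupp.mem_support_iff.1 hη this
    · rw [← ofCoeff_add, Finsupp.filter_add_filter_not]
    · by_contra hne
      exact hγ (Finsupp.filter_apply_neg _ _ hne)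
    · have hne : ¬ ℓ γ = ℓ η := fun h ↦ hγ (Finsupp.filter_apply_neg _ _ (not_not.2 h))
      refine lt_of_le_of_ne (hmax γ (Finsupp.mem_support_iff.2 fun h ↦ hγ ?_)) hne
      simp [hne, h]
  obtain ⟨a, x₁, x₂, ha, hx₁, rfl, hxa, hxb⟩ := top x α hα
  obtain ⟨b, y₁, y₂, hb, hy₁, rfl, hya, hyb⟩ := top y β hβ
  obtain ⟨γ, hγ⟩ : ∃ γ, (x₁ * y₁).coeff γ ≠ 0 := by
    by_contra! h
    exact mul_ne_zero hx₁ hy₁ (coeff_injective (Finsupp.ext h))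
  have hγd : ℓ γ = a + b := by
    obtain ⟨α', β', h1, h2, rfl⟩ := exists_of_coeff_mul_ne_zero hγ
    rw [map_add, hxa _ h1, hya _ h2]
  refine ⟨γ, ?_, by omega⟩
  have z1 : (x₁ * y₂).coeff γ = 0 := by
    by_contra h
    obtain ⟨α', β', h1, h2, rfl⟩ := exists_of_coeff_mul_ne_zero h
    have := hxa _ h1; have := hyb _ h2; rw [map_add] at hγd; omega
  have z2 : (x₂ * (y₁ + y₂)).coeff γ = 0 := by
    by_contra h
    obtain ⟨α', β', h1, h2, rfl⟩ := exists_of_coeff_mul_ne_zero h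
    have h3 := hxb _ h1
    have h4 : ℓ β' ≤ b := by
      by_cases h5 : y₁.coeff β' = 0
      · refine (hyb β' fun h6 ↦ h2 ?_).le
        simp [h5, h6]
      · exact (hya _ h5).le
    rw [map_add] at hγd; omega
  rw [add_mul, mul_add]
  simpa [z1, z2] using hγ

end

section

variable {R : Type*} [CommRing R] [IsDomain R] {n : ℕ}

/-- Over a domain, the units of a Laurent polynomial ring with augmentation `1` are the
monomials. -/
theorem exists_eq_single_of_mul_eq_one {x y : AddMonoidAlgebra R (Fin n → ℤ)} (h : x * y = 1)
    (hx : augmentation R _ x = 1) : ∃ γ, x = single γ 1 := by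
  have hx0 : x ≠ 0 := fun h0 ↦ by simp [h0] at hx
  have hy0 : y ≠ 0 := fun h0 ↦ by simp [h0] at h
  have ex (z : AddMonoidAlgebra R (Fin n → ℤ)) (hz : z ≠ 0) : ∃ γ, z.coeff γ ≠ 0 := by
    by_contra! h'
    exact hz (coeff_injective (Finsupp.ext h'))
  obtain ⟨α, hα⟩ := ex x hx0
  obtain ⟨β, hβ⟩ := ex y hy0
  have key (α' : Fin n → ℤ) (hα' : x.coeff α' ≠ 0) (ℓ : (Fin n → ℤ) →+ ℤ) :
      ℓ α' + ℓ β ≤ 0 := by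
    obtain ⟨γ, hγ, hle⟩ := exists_le_of_coeff_ne_zero ℓ hα' hβ
    rw [h, one_def] at hγ
    have : γ = 0 := by
      by_contra hne
      exact hγ (by simp [Ne.symm hne])
    simpa [this] using hle
  have key' (α' : Fin n → ℤ) (hα' : x.coeff α' ≠ 0) : α' = -β := by
    funext j
    have h1 := key α' hα' (Pi.evalAddMonoidHom _ j)
    have h2 := key α' hα' (-Pi.evalAddMonoidHom _ j)
    simp at h1 h2 ⊢
    omega
  refine ⟨-β, ?_⟩
  have hs : x = single (-β) (x.coeff (-β)) := by
    apply coeff_injective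
    ext γ
    by_cases hγ : x.coeff γ = 0
    · rw [hγ]
      by_cases hγβ : γ = -β
      · subst hγβ; simp [hγ]
      · simp [Ne.symm hγβ]
    · rw [key' γ hγ]; simp
  rw [hs] at hx ⊢
  simpa using hx

end

end AddMonoidAlgebra

section

open Polynomial IsLocalRing

namespace AddMonoidAlgebra

theorem exists_coeff_ne_zero {R Γ : Type*} [Semiring R] {x : AddMonoidAlgebra R Γ} (h : x ≠ 0) :
    ∃ γ, x.coeff γ ≠ 0 := by
  by_contra! h'
  exact h (coeff_injective (Finsupp.ext h'))

section

variable {F : Type*} [Field F] {n : ℕ} (V : ValuationSubring F)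

/-- A nonzero Laurent polynomial over a valued field is a constant times a polynomial over the
valuation ring with nonzero reduction. -/
theorem exists_eq_smul_mapRingHom {f : AddMonoidAlgebra F (Fin n → ℤ)} (hf : f ≠ 0) :
    ∃ (a : F) (f₀ : AddMonoidAlgebra V (Fin n → ℤ)), a ≠ 0 ∧
      f = a • mapRingHom _ V.subtype f₀ ∧ mapRingHom _ (residue V) f₀ ≠ 0 := by
  obtain ⟨γ, hγ⟩ := exists_coeff_ne_zero hf
  obtain ⟨η, hη, hmax⟩ := Finset.exists_max_image f.coeff.support
    (fun γ ↦ V.valuation (f.coeff γ)) ⟨γ, Finsupp.mem_support_iff.2 hγ⟩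
  have ha : f.coeff η ≠ 0 := Finsupp.mem_support_iff.1 hη
  obtain ⟨f₀, hf₀⟩ := exists_mapRingHom_eq V.subtype ((f.coeff η)⁻¹ • f) fun γ ↦ by
    have : (f.coeff η)⁻¹ * f.coeff γ ∈ V := by
      rw [← V.valuation_le_one_iff, map_mul, map_inv₀]
      by_cases hγ : f.coeff γ = 0
      · simp [hγ]
      · have h1 := hmax γ (Finsupp.mem_support_iff.2 hγ)
        have h2 : 0 < V.valuation (f.coeff η) := by
          simpa [zero_lt_iff] using ha
        rw [mul_comm, ← div_eq_mul_inv]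
        exact div_le_one_of_le₀ h1 zero_le
    exact ⟨⟨_, this⟩, by simp⟩
  refine ⟨f.coeff η, f₀, ha, ?_, fun h ↦ ?_⟩
  · rw [hf₀, smul_smul, mul_inv_cancel₀ ha, one_smul]
  · have h1 := congr_arg (fun z ↦ z.coeff η) h
    have h2 := congr_arg (fun z ↦ z.coeff η) hf₀
    simp only [coeff_mapRingHom, coeff_zero, Finsupp.coe_zero, Pi.zero_apply] at h1
    have h3 : f₀.coeff η = 1 := Subtype.val_injective (by simpa [ha] using h2)
    simp [h3] at h1

theorem coeff_mem_of_mul_eq {f g : AddMonoidAlgebra F (Fin n → ℤ)}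
    (h : ∀ γ, (f * g).coeff γ ∈ V) (hg : augmentation F _ g ≠ 0)
    (hg' : (augmentation F _ g)⁻¹ ∈ V) (γ : Fin n → ℤ) : f.coeff γ ∈ V := by
  by_cases hf : f = 0
  · simp [hf]
  have hg0 : g ≠ 0 := by rintro rfl; simp at hg
  obtain ⟨a, f₀, ha, rfl, hf₀⟩ := exists_eq_smul_mapRingHom V hf
  obtain ⟨b, g₀, hb, rfl, hg₀⟩ := exists_eq_smul_mapRingHom V hg0
  obtain ⟨η, hη⟩ := exists_coeff_ne_zero (mul_ne_zero hf₀ hg₀)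
  have hu : IsUnit ((f₀ * g₀).coeff η) := by
    rw [← isUnit_map_iff (residue V), isUnit_iff_ne_zero]
    rwa [← map_mul, coeff_mapRingHom] at hη
  have hab : a * b ∈ V := by
    have h1 := h η
    rw [smul_mul_smul_comm, ← map_mul] at h1
    obtain ⟨v, hv⟩ := hu.exists_right_inv
    have h2 : ((f₀ * g₀).coeff η : F) * v = 1 := by exact_mod_cast congr_arg Subtype.val hv
    have h3 := V.mul_mem _ _ h1 v.2
    have h4 : (a * b) * ((f₀ * g₀).coeff η : F) * v = a * b := by rw [mul_assoc, h2, mul_one]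
    rw [coeff_smul, Finsupp.smul_apply, coeff_mapRingHom, smul_eq_mul] at h3
    rw [← h4]
    exact h3
  have hbi : b⁻¹ ∈ V := by
    have h1 : augmentation F (Fin n → ℤ) (b • mapRingHom _ V.subtype g₀) =
        b * (augmentation V _ g₀ : F) := by
      rw [map_smul, augmentation_mapRingHom]; rfl
    rw [h1] at hg hg'
    have h2 := V.mul_mem _ _ hg' (augmentation V _ g₀).2
    rw [mul_inv, mul_assoc, inv_mul_cancel₀ (right_ne_zero_of_mul hg), mul_one] at h2
    exact h2
  have haV : a ∈ V := by
    have := V.mul_mem _ _ hab hbi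
    rwa [mul_assoc, mul_inv_cancel₀ hb, mul_one] at this
  simpa using V.mul_mem _ _ haV (f₀.coeff γ).2

end

/-- A form of Kronecker's theorem: if `f * g` has coefficients in `A` and the augmentation of `g`
is a unit of `A`, then the coefficients of `f` are integral over `A`. -/
theorem isIntegral_coeff_of_mul_eq {A L : Type*} [CommRing A] [CommRing L] [Algebra A L] {n : ℕ}
    {f g : AddMonoidAlgebra L (Fin n → ℤ)} {m : AddMonoidAlgebra A (Fin n → ℤ)} {u : A}
    (h : f * g = mapRingHom _ (algebraMap A L) m) (hu : IsUnit u)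
    (hg : augmentation L _ g = algebraMap A L u) (γ : Fin n → ℤ) :
    IsIntegral A (f.coeff γ) := by
  by_contra hx
  set x := f.coeff γ
  let M : Submonoid L :=
    { carrier := {y | ∃ p : A[X], p.Monic ∧ aeval x p = y}
      one_mem' := ⟨1, Polynomial.monic_one, by simp⟩
      mul_mem' := by
        rintro _ _ ⟨p, hp, rfl⟩ ⟨q, hq, rfl⟩
        exact ⟨p * q, hp.mul hq, by simp⟩ }
  have hM : Disjoint ((⊥ : Ideal L) : Set L) (M : Set L) := by
    rw [Set.disjoint_left]
    rintro y hy ⟨p, hp, hpy⟩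
    exact hx ⟨p, hp, hpy.trans hy⟩
  obtain ⟨q, hq, -, hqM⟩ := Ideal.exists_le_prime_disjoint _ M hM
  let F := FractionRing (L ⧸ q)
  let φ : L →ₐ[A] F := IsScalarTower.toAlgHom A L F
  have hφ (y : L) (hy : φ y = 0) : y ∈ q := by
    have h1 : algebraMap (L ⧸ q) F (Ideal.Quotient.mk q y) = 0 := hy
    rw [map_eq_zero_iff _ (IsFractionRing.injective (L ⧸ q) F)] at h1
    exact Ideal.Quotient.eq_zero_iff_mem.1 h1
  have hφA : (φ : L →+* F).comp (algebraMap A L) = algebraMap A F := φ.comp_algebraMap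
  have hm := congr_arg (mapRingHom (Fin n → ℤ) (φ : L →+* F)) h
  rw [map_mul, ← RingHom.comp_apply, ← mapRingHom_comp, hφA] at hm
  have hg2 := (augmentation_mapRingHom (φ : L →+* F) g).trans
    ((congr_arg φ hg).trans (φ.commutes u))
  have hmem : φ x ∈
      (integralClosure (Subring.closure (Set.range (algebraMap A F))) F).toSubring := by
    rw [← iInf_valuationSubring_superset]
    rw [Subring.mem_iInf]
    rintro ⟨V, hV⟩
    have hVA (a : A) : algebraMap A F a ∈ V := hV ⟨a, rfl⟩
    have := coeff_mem_of_mul_eq V (f := mapRingHom _ (φ : L →+* F) f)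
      (g := mapRingHom _ (φ : L →+* F) g) (fun γ ↦ ?_) ?_ ?_ γ
    · simpa using this
    · rw [hm]; simpa using hVA _
    · rw [hg2]; exact (hu.map _).ne_zero
    · rw [hg2]
      obtain ⟨v, hv⟩ := hu.exists_right_inv
      rw [inv_eq_of_mul_eq_one_right (b := algebraMap A F v) (by rw [← map_mul, hv, map_one])]
      exact hVA v
  have hInt : IsIntegral A (φ x) := by
    obtain ⟨p, hp, hpx⟩ := hmem
    have hcl : Subring.closure (Set.range (algebraMap A F)) = (algebraMap A F).range := by
      rw [← RingHom.coe_range, Subring.closure_eq]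
    have hlift : p.map (algebraMap _ F) ∈ Polynomial.lifts (algebraMap A F) := by
      rw [Polynomial.lifts_iff_coeff_lifts]
      intro k
      rw [Polynomial.coeff_map]
      have := (p.coeff k).2
      exact hcl.le this
    obtain ⟨r, hr, -, hrm⟩ := Polynomial.lifts_and_degree_eq_and_monic hlift (hp.map _)
    refine ⟨r, hrm, ?_⟩
    rw [← eval_map, hr, eval_map]
    exact hpx
  obtain ⟨p, hp, hpx⟩ := hInt
  refine Set.disjoint_left.1 hqM (hφ (aeval x p) ?_) ⟨p, hp, rfl⟩
  rw [← aeval_algHom_apply]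
  exact hpx

end AddMonoidAlgebra

end

/-- Over a GCD domain, a nonzero matrix with vanishing `2 × 2` minors is the product of a column
and a row. -/
theorem exists_eq_mul_of_minors {R ι : Type*} [CommRing R] [IsDomain R] [NormalizedGCDMonoid R]
    [Fintype ι] {m : ι → ι → R} (hm : ∀ i j k l, m i j * m k l = m i l * m k j) {i₀ j₀ : ι}
    (h₀ : m i₀ j₀ ≠ 0) : ∃ f g : ι → R, ∀ i j, m i j = f i * g j := by
  obtain ⟨g, hg, hg1⟩ := Finset.extract_gcd (s := Finset.univ) (m i₀) ⟨i₀, Finset.mem_univ _⟩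
  replace hg j := hg j (Finset.mem_univ _)
  set d := Finset.univ.gcd (m i₀)
  have hd : d ≠ 0 := fun h ↦ h₀ (by rw [hg, h, zero_mul])
  have hgj : g j₀ ≠ 0 := fun h ↦ h₀ (by rw [hg, h, mul_zero])
  have hmg (i j l) : m i j * g l = m i l * g j := by
    apply mul_left_cancel₀ hd
    have := hm i j i₀ l
    rw [hg l, hg j] at this
    linear_combination this
  have hdvd (i) : g j₀ ∣ m i j₀ := by
    have h1 : g j₀ ∣ Finset.univ.gcd fun l ↦ m i j₀ * g l :=
      Finset.dvd_gcd fun l _ ↦ ⟨m i l, by rw [hmg, mul_comm]⟩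
    exact h1.trans (by simpa [hg1] using (Finset.univ.gcd_mul_left' (f := g) (m i j₀)).dvd)
  choose f hf using hdvd
  refine ⟨f, g, fun i j ↦ mul_right_cancel₀ hgj ?_⟩
  rw [hmg, hf]
  ring

namespace AddMonoidAlgebra

section

variable (n : ℕ)

/-- The inclusion of exponents of monomials into exponents of Laurent monomials. -/
def exponentHom : (Fin n →₀ ℕ) →+ (Fin n → ℤ) where
  toFun γ k := γ k
  map_zero' := by ext; simp
  map_add' _ _ := by ext; simp

theorem exponentHom_injective : Function.Injective (exponentHom n) := fun α β h ↦ by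
  ext k
  exact Nat.cast_injective (R := ℤ) (congr_fun h k)

variable {n} {F : Type*} [Field F]

theorem exists_single_mul_eq (x : AddMonoidAlgebra F (Fin n → ℤ)) :
    ∃ N : Fin n → ℤ, ∀ N', N ≤ N' → ∃ y : MvPolynomial (Fin n) F,
      mapDomainRingHom F (exponentHom n) y = single N' 1 * x := by
  induction x using AddMonoidAlgebra.induction_linear with
  | zero => exact ⟨0, fun _ _ ↦ ⟨0, by simp⟩⟩
  | add x y hx hy =>
    obtain ⟨N, hN⟩ := hx
    obtain ⟨M, hM⟩ := hy
    refine ⟨N ⊔ M, fun N' h ↦ ?_⟩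
    obtain ⟨a, ha⟩ := hN N' (le_sup_left.trans h)
    obtain ⟨b, hb⟩ := hM N' (le_sup_right.trans h)
    exact ⟨a + b, by rw [map_add, ha, hb, mul_add]⟩
  | single γ r =>
    refine ⟨-γ, fun N' h ↦ ⟨MvPolynomial.monomial
      (Finsupp.equivFunOnFinite.symm fun k ↦ (N' k + γ k).toNat) r, ?_⟩⟩
    rw [single_mul_single, one_mul]
    refine (mapDomain_single ..).trans ?_
    congr 1
    ext k
    have := h k
    simp [exponentHom] at this ⊢
    omega

theorem exists_eq_mul_of_minors {ι : Type*} [Finite ι]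
    {m : ι → ι → AddMonoidAlgebra F (Fin n → ℤ)}
    (hm : ∀ i j k l, m i j * m k l = m i l * m k j) {i₀ : ι}
    (h₀ : augmentation F _ (m i₀ i₀) ≠ 0) :
    ∃ f g : ι → AddMonoidAlgebra F (Fin n → ℤ), (∀ i j, m i j = f i * g j) ∧
      augmentation F _ (f i₀) = 1 := by
  cases nonempty_fintype ι
  choose N hN using fun p : ι × ι ↦ exists_single_mul_eq (m p.1 p.2)
  let N₀ : Fin n → ℤ := Finset.univ.sup' ⟨(i₀, i₀), Finset.mem_univ _⟩ N
  choose y hy using fun i j ↦ hN (i, j) N₀ (Finset.le_sup' N (Finset.mem_univ (i, j)))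
  let Φ := mapDomainRingHom F (exponentHom n)
  have hΦ : Function.Injective Φ := mapDomain_injective (exponentHom_injective n)
  have hs : (single (-N₀) 1 : AddMonoidAlgebra F (Fin n → ℤ)) * single N₀ 1 = 1 := by
    simp [single_mul_single, one_def]
  have hmy i j : m i j = single (-N₀) 1 * Φ (y i j) := by
    rw [hy, ← mul_assoc, hs, one_mul]
  obtain ⟨_⟩ : Nonempty (NormalizedGCDMonoid (MvPolynomial (Fin n) F)) := inferInstance
  obtain ⟨f, g, hfg⟩ := _root_.exists_eq_mul_of_minors (m := y) (i₀ := i₀) (j₀ := i₀)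
    (fun i j k l ↦ hΦ (by
      rw [map_mul, map_mul, hy, hy, hy, hy]
      linear_combination single N₀ 1 * single N₀ 1 * hm i j k l)) (fun h ↦ h₀ (by
        rw [hmy, h, map_zero, mul_zero, map_zero]))
  set c := augmentation F _ (Φ (f i₀)) with hc
  have hc0 : c ≠ 0 := fun h ↦ h₀ (by
    rw [hmy, hfg, map_mul, map_mul, map_mul, ← hc, h, zero_mul, mul_zero])
  refine ⟨fun i ↦ c⁻¹ • Φ (f i), fun j ↦ c • (single (-N₀) 1 * Φ (g j)), fun i j ↦ ?_, ?_⟩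
  · rw [smul_mul_smul_comm, inv_mul_cancel₀ hc0, one_smul, hmy, hfg, map_mul]
    ring
  · rw [map_smul, ← hc, smul_eq_mul, inv_mul_cancel₀ hc0]

end

/-- Two factorizations of a rank-one matrix of trace one over a Laurent polynomial ring, normalized
by augmentation, differ by a monomial. -/
theorem exists_single_mul_eq_of_mul_eq_mul {R ι : Type*} [CommRing R] [IsDomain R] [Fintype ι]
    {n : ℕ} {f f' g g' : ι → AddMonoidAlgebra R (Fin n → ℤ)}
    (h : ∀ i j, f i * g j = f' i * g' j) (ht : ∑ i, f i * g i = 1) {i₀ : ι}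
    (hf : augmentation R _ (f i₀) = 1) (hf' : augmentation R _ (f' i₀) = 1) :
    ∃ γ, ∀ i, f i = single γ 1 * f' i := by
  have hw : (∑ i, f i * g' i) * (∑ i, f' i * g i) = 1 := by
    rw [← mul_one (1 : AddMonoidAlgebra R (Fin n → ℤ)), ← ht, Finset.sum_mul_sum,
      Finset.sum_mul_sum]
    refine Finset.sum_congr rfl fun i _ ↦ Finset.sum_congr rfl fun j _ ↦ ?_
    linear_combination -(f i * g j) * h j i
  have hfw k : f k = (∑ i, f i * g' i) * f' k := by
    rw [← mul_one (f k), ← ht, Finset.mul_sum, Finset.sum_mul]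
    refine Finset.sum_congr rfl fun i _ ↦ ?_
    linear_combination f i * h k i
  have haug : augmentation R _ (∑ i, f i * g' i) = 1 := by
    have := congr_arg (augmentation R _) (hfw i₀)
    rwa [map_mul, hf, hf', mul_one, eq_comm] at this
  obtain ⟨γ, hγ⟩ := exists_eq_single_of_mul_eq_one hw haug
  exact ⟨γ, fun k ↦ by rw [← hγ, ← hfw]⟩

end AddMonoidAlgebra

section

open IsLocalRing AddMonoidAlgebra

/-- If `y` has a fixed monomial in its support, the support of `x` is bounded in terms of that of
`x * y`. -/
theorem AddMonoidAlgebra.exists_finset_coeff_eq_zero {n : ℕ} (s : Finset (Fin n → ℤ))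
    (δ : Fin n → ℤ) : ∃ t : Finset (Fin n → ℤ), ∀ {F : Type*} [CommRing F] [IsDomain F]
      {x y : AddMonoidAlgebra F (Fin n → ℤ)}, y.coeff δ ≠ 0 →
      (∀ γ, γ ∉ s → (x * y).coeff γ = 0) → ∀ γ, γ ∉ t → x.coeff γ = 0 := by
  obtain ⟨a, ha⟩ := s.bddBelow
  obtain ⟨b, hb⟩ := s.bddAbove
  refine ⟨Finset.Icc (a - δ) (b - δ), fun hδ hs γ hγ ↦ ?_⟩
  by_contra hne
  refine hγ (Finset.mem_Icc.2 ⟨fun k ↦ ?_, fun k ↦ ?_⟩)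
  · obtain ⟨η, hη, hle⟩ := exists_le_of_coeff_ne_zero (-Pi.evalAddMonoidHom _ k) hne hδ
    have : a k ≤ η k := ha (not_not.1 (mt (hs η) hη)) k
    simp at hle ⊢
    omega
  · obtain ⟨η, hη, hle⟩ := exists_le_of_coeff_ne_zero (Pi.evalAddMonoidHom _ k) hne hδ
    have : η k ≤ b k := hb (not_not.1 (mt (hs η) hη)) k
    simp at hle ⊢
    omega

theorem AddMonoidAlgebra.mapRingHom_injective {R S Γ : Type*} [CommRing R] [CommRing S]
    [AddCommGroup Γ] (φ : R →+* S) (hφ : Function.Injective φ) :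
    Function.Injective (mapRingHom Γ φ) :=
  map_injective (φ : R →+ S) hφ

/-- A factorization over an `A`-algebra `R` of a rank-one matrix `m` of Laurent polynomials over
a local ring `A` as a column times a row, normalized by augmentation and by its reduction. -/
structure IsCanonicalFactorization {A : Type*} [CommRing A] [IsLocalRing A] {n : ℕ} {ι : Type*}
    (m : ι → ι → AddMonoidAlgebra A (Fin n → ℤ)) (i₀ : ι) (f₀ : ι → AddMonoidAlgebra A (Fin n → ℤ))
    {R : Type*} [CommRing R] [Algebra A R] (f g : ι → AddMonoidAlgebra R (Fin n → ℤ)) :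
    Prop where
  mul_eq i j : f i * g j = mapRingHom _ (algebraMap A R) (m i j)
  augmentation_eq : augmentation R _ (f i₀) = 1
  residual i γ : IsResiduallyNilpotent A ((f i).coeff γ - algebraMap A R ((f₀ i).coeff γ))

namespace IsCanonicalFactorization

section

variable {A : Type*} [CommRing A] [IsLocalRing A] {n : ℕ} {ι : Type*}
  {m : ι → ι → AddMonoidAlgebra A (Fin n → ℤ)} {i₀ : ι} {f₀ : ι → AddMonoidAlgebra A (Fin n → ℤ)}
  {R S : Type*} [CommRing R] [Algebra A R] [CommRing S] [Algebra A S]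
  {f g : ι → AddMonoidAlgebra R (Fin n → ℤ)}

theorem map (h : IsCanonicalFactorization m i₀ f₀ f g) (φ : R →ₐ[A] S) :
    IsCanonicalFactorization m i₀ f₀ (fun i ↦ mapRingHom _ (φ : R →+* S) (f i))
      (fun i ↦ mapRingHom _ (φ : R →+* S) (g i)) where
  mul_eq i j := by
    rw [← map_mul, h.mul_eq, ← RingHom.comp_apply, ← mapRingHom_comp, φ.comp_algebraMap]
  augmentation_eq := by rw [augmentation_mapRingHom, h.augmentation_eq, map_one]
  residual i γ := by simpa using (h.residual i γ).map φ

theorem map_eq (h : IsCanonicalFactorization m i₀ f₀ f g) [IsDomain S] (φ : R →ₐ[A] S)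
    (hS : maximalIdeal A ≤ RingHom.ker (algebraMap A S)) (i : ι) :
    mapRingHom _ (φ : R →+* S) (f i) = mapRingHom _ (algebraMap A S) (f₀ i) := by
  apply coeff_injective
  ext γ
  have h1 := ((h.residual i γ).map φ).mem (⊥ : Ideal S) hS
  simpa [sub_eq_zero] using h1

theorem of_map (φ : R →ₐ[A] S) (hφ : Function.Injective φ)
    (h : IsCanonicalFactorization m i₀ f₀ (fun i ↦ mapRingHom _ (φ : R →+* S) (f i))
      (fun i ↦ mapRingHom _ (φ : R →+* S) (g i))) : IsCanonicalFactorization m i₀ f₀ f g where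
  mul_eq i j := by
    apply mapRingHom_injective (φ : R →+* S) hφ
    rw [map_mul, ← RingHom.comp_apply, ← mapRingHom_comp, φ.comp_algebraMap]
    exact h.mul_eq i j
  augmentation_eq := by
    have := h.augmentation_eq
    rw [augmentation_mapRingHom] at this
    exact hφ (by simpa using this)
  residual i γ := by
    rw [← isResiduallyNilpotent_map_iff φ hφ]
    simpa using h.residual i γ

end

end IsCanonicalFactorization

end

section

open IsLocalRing AddMonoidAlgebra

section

variable {A : Type*} [CommRing A] {n : ℕ} {ι : Type*}
  {m : ι → ι → AddMonoidAlgebra A (Fin n → ℤ)} {i₀ : ι}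

theorem isIntegral_coeff_of_factorization {L : Type*} [CommRing L] [Algebra A L]
    {f g : ι → AddMonoidAlgebra L (Fin n → ℤ)}
    (h : ∀ i j, f i * g j = mapRingHom _ (algebraMap A L) (m i j))
    (hf : augmentation L _ (f i₀) = 1) (hu : IsUnit (augmentation A _ (m i₀ i₀))) (i : ι)
    (γ : Fin n → ℤ) : IsIntegral A ((f i).coeff γ) ∧ IsIntegral A ((g i).coeff γ) := by
  refine ⟨isIntegral_coeff_of_mul_eq (h i i₀) hu ?_ γ,
    isIntegral_coeff_of_mul_eq ((mul_comm _ _).trans (h i₀ i)) isUnit_one (by simpa using hf) γ⟩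
  have := congr_arg (augmentation L _) (h i₀ i₀)
  rwa [map_mul, hf, one_mul, augmentation_mapRingHom] at this

theorem exists_integralClosure_factorization {L : Type*} [CommRing L] [Algebra A L]
    {f g : ι → AddMonoidAlgebra L (Fin n → ℤ)}
    (h : ∀ i j, f i * g j = mapRingHom _ (algebraMap A L) (m i j))
    (hf : augmentation L _ (f i₀) = 1) (hu : IsUnit (augmentation A _ (m i₀ i₀))) :
    ∃ f' g' : ι → AddMonoidAlgebra (integralClosure A L) (Fin n → ℤ),
      (∀ i, mapRingHom _ ((integralClosure A L).val : integralClosure A L →+* L) (f' i) = f i) ∧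
      (∀ i, mapRingHom _ ((integralClosure A L).val : integralClosure A L →+* L) (g' i) = g i) ∧
      (∀ i j, f' i * g' j = mapRingHom _ (algebraMap A (integralClosure A L)) (m i j)) ∧
      augmentation (integralClosure A L) _ (f' i₀) = 1 := by
  have hInt := isIntegral_coeff_of_factorization h hf hu
  choose f' hf' using fun i ↦ exists_mapRingHom_eq
    ((integralClosure A L).val : integralClosure A L →+* L) (f i)
    fun γ ↦ ⟨(⟨_, (hInt i γ).1⟩ : integralClosure A L), rfl⟩
  choose g' hg' using fun i ↦ exists_mapRingHom_eq
    ((integralClosure A L).val : integralClosure A L →+* L) (g i)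
    fun γ ↦ ⟨(⟨_, (hInt i γ).2⟩ : integralClosure A L), rfl⟩
  have hinj : Function.Injective ((integralClosure A L).val : integralClosure A L →+* L) :=
    fun _ _ h ↦ Subtype.ext h
  refine ⟨f', g', hf', hg', fun i j ↦ mapRingHom_injective _ hinj ?_, hinj ?_⟩
  · rw [map_mul, hf', hg', h, ← RingHom.comp_apply, ← mapRingHom_comp, AlgHom.comp_algebraMap]
  · rw [← augmentation_mapRingHom, hf', hf, map_one]

end

namespace IsCanonicalFactorization

variable {A : Type*} [CommRing A] [HenselianLocalRing A] {n : ℕ} {ι : Type*}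
  {m : ι → ι → AddMonoidAlgebra A (Fin n → ℤ)} {i₀ : ι} {f₀ : ι → AddMonoidAlgebra A (Fin n → ℤ)}
  {f₁ g₁ : ι → AddMonoidAlgebra (ResidueField A) (Fin n → ℤ)}

/-- A domain integral over a henselian local ring `A` has a residue field. -/
theorem exists_residue_algHom.{w} (O : Type w) [CommRing O] [IsDomain O] [Algebra A O]
    [Algebra.IsIntegral A O] : ∃ (S : Type w) (_ : Field S) (_ : Algebra A S) (φ : O →ₐ[A] S)
      (_ : ResidueField A →ₐ[A] S), maximalIdeal A ≤ RingHom.ker (algebraMap A S) ∧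
      ∀ x, φ x = 0 → IsResiduallyNilpotent A x := by
  obtain ⟨I, hI⟩ := Ideal.exists_maximal O
  have hS : maximalIdeal A ≤ RingHom.ker (algebraMap A (O ⧸ I)) := fun a ha ↦ by
    rw [RingHom.mem_ker, IsScalarTower.algebraMap_apply A O (O ⧸ I)]
    exact Ideal.Quotient.eq_zero_iff_mem.2 (IsLocalRing.maximalIdeal_le_comap (A := A) I ha)
  refine ⟨O ⧸ I, Ideal.Quotient.field I, inferInstance, Ideal.Quotient.mkₐ A I,
    Ideal.Quotient.liftₐ (maximalIdeal A) (Algebra.ofId A _) fun _ ha ↦ hS ha, hS, fun x hx ↦ ?_⟩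
  rw [← mem_maximal_iff_isResiduallyNilpotent I]
  exact Ideal.Quotient.eq_zero_iff_mem.1 hx

theorem ne_zero {R : Type*} [CommRing R] [Nontrivial R] [Algebra A R]
    {f g : ι → AddMonoidAlgebra R (Fin n → ℤ)} (h : IsCanonicalFactorization m i₀ f₀ f g) :
    f i₀ ≠ 0 := fun h0 ↦ by
  have := h.augmentation_eq
  rw [h0, map_zero] at this
  exact zero_ne_one this

section

variable {O : Type*} [CommRing O] [IsDomain O] [Algebra A O] [Algebra.IsIntegral A O]

theorem exists_of_isIntegral [Fintype ι] (ht : ∑ i, m i i = 1)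
    (h₁ : IsCanonicalFactorization m i₀ f₀ f₁ g₁) {f g : ι → AddMonoidAlgebra O (Fin n → ℤ)}
    (h : ∀ i j, f i * g j = mapRingHom _ (algebraMap A O) (m i j))
    (hf : augmentation O _ (f i₀) = 1) :
    ∃ f g : ι → AddMonoidAlgebra O (Fin n → ℤ), IsCanonicalFactorization m i₀ f₀ f g := by
  obtain ⟨S, _, _, φ, σ, hS, hφ⟩ := exists_residue_algHom (A := A) O
  have h₂ := h₁.map σ
  have hφ' (i j) : mapRingHom _ (φ : O →+* S) (f i) * mapRingHom _ (φ : O →+* S) (g j) =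
      mapRingHom _ (algebraMap A S) (m i j) := by
    rw [← map_mul, h, ← RingHom.comp_apply, ← mapRingHom_comp, φ.comp_algebraMap]
  have ht' : ∑ i, mapRingHom _ (φ : O →+* S) (f i) * mapRingHom _ (φ : O →+* S) (g i) = 1 := by
    rw [Finset.sum_congr rfl fun i _ ↦ hφ' i i, ← map_sum, ht, map_one]
  have hf' : augmentation S _ (mapRingHom _ (φ : O →+* S) (f i₀)) = 1 := by
    rw [augmentation_mapRingHom, hf, map_one]
  obtain ⟨γ, hγ⟩ := exists_single_mul_eq_of_mul_eq_mul
    (fun i j ↦ (hφ' i j).trans (h₂.mul_eq i j).symm) ht' hf' h₂.augmentation_eq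
  have hs : (single (-γ) 1 : AddMonoidAlgebra O (Fin n → ℤ)) * single γ 1 = 1 := by
    simp [single_mul_single, one_def]
  refine ⟨fun i ↦ single (-γ) 1 * f i, fun i ↦ single γ 1 * g i, fun i j ↦ ?_, ?_, fun i ε ↦ ?_⟩
  · rw [← h]
    linear_combination (f i * g j) * hs
  · simp [hf]
  · apply hφ
    have h3 := hγ i
    rw [h₁.map_eq σ hS] at h3
    have h4 : mapRingHom _ (φ : O →+* S) (single (-γ) 1 * f i) =
        mapRingHom _ (algebraMap A S) (f₀ i) := by
      rw [map_mul, h3, ← mul_assoc]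
      simp [single_mul_single, ← one_def]
    have h5 := congr_arg (fun x ↦ x.coeff ε) h4
    rw [coeff_mapRingHom, coeff_mapRingHom] at h5
    rw [map_sub, sub_eq_zero, φ.commutes]
    exact h5

theorem eq_of_isIntegral [Fintype ι] (ht : ∑ i, m i i = 1)
    {f g f' g' : ι → AddMonoidAlgebra O (Fin n → ℤ)} (h : IsCanonicalFactorization m i₀ f₀ f g)
    (h' : IsCanonicalFactorization m i₀ f₀ f' g') : f = f' ∧ g = g' := by
  have hff : f = f' := by
    obtain ⟨γ, hγ⟩ := exists_single_mul_eq_of_mul_eq_mul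
      (fun i j ↦ (h.mul_eq i j).trans (h'.mul_eq i j).symm)
      (by simp_rw [h.mul_eq, ← map_sum, ht, map_one]) h.augmentation_eq h'.augmentation_eq
    obtain ⟨S, _, _, φ, -, hS, -⟩ := exists_residue_algHom (A := A) O
    have h1 := congr_arg (mapRingHom _ (φ : O →+* S)) (hγ i₀)
    have h2 := (h'.map φ).ne_zero
    rw [map_mul, h.map_eq φ hS, ← h'.map_eq φ hS] at h1
    have h3 := mul_right_cancel₀ h2 ((one_mul _).trans h1)
    have h4 : γ = 0 := by
      by_contra hne
      have := congr_arg (fun x ↦ x.coeff γ) h3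
      simp [one_def, Ne.symm hne] at this
    funext i
    rw [hγ, h4, ← one_def, one_mul]
  refine ⟨hff, funext fun j ↦ mul_left_cancel₀ h.ne_zero ?_⟩
  rw [h.mul_eq, hff, h'.mul_eq]

theorem coeff_ne_zero_of_isIntegral {f g : ι → AddMonoidAlgebra O (Fin n → ℤ)}
    (h₁ : IsCanonicalFactorization m i₀ f₀ f₁ g₁) (h : IsCanonicalFactorization m i₀ f₀ f g)
    (i : ι) (γ : Fin n → ℤ) :
    ((f₁ i).coeff γ ≠ 0 → (f i).coeff γ ≠ 0) ∧ ((g₁ i).coeff γ ≠ 0 → (g i).coeff γ ≠ 0) := by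
  obtain ⟨S, _, _, φ, σ, hS, -⟩ := exists_residue_algHom (A := A) O
  have hfe i : mapRingHom _ (φ : O →+* S) (f i) =
      mapRingHom _ (σ : ResidueField A →+* S) (f₁ i) := by
    rw [h.map_eq φ hS, h₁.map_eq σ hS]
  have hge : mapRingHom _ (φ : O →+* S) (g i) =
      mapRingHom _ (σ : ResidueField A →+* S) (g₁ i) := by
    refine mul_left_cancel₀ (h.map φ).ne_zero ?_
    rw [(h.map φ).mul_eq, hfe]
    exact ((h₁.map σ).mul_eq _ _).symm
  have key {x : AddMonoidAlgebra O (Fin n → ℤ)} {y : AddMonoidAlgebra (ResidueField A) (Fin n → ℤ)}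
      (hxy : mapRingHom _ (φ : O →+* S) x = mapRingHom _ (σ : ResidueField A →+* S) y)
      (hy : y.coeff γ ≠ 0) : x.coeff γ ≠ 0 := fun h0 ↦ by
    have h4 := congr_arg (fun x ↦ x.coeff γ) hxy
    simp only [coeff_mapRingHom] at h4
    rw [h0, map_zero] at h4
    exact hy ((σ : ResidueField A →+* S).injective (h4.symm.trans (map_zero _).symm))
  exact ⟨key (hfe i), key hge⟩

end

theorem lift_integralClosure {L : Type*} [CommRing L] [Algebra A L]
    {f g : ι → AddMonoidAlgebra L (Fin n → ℤ)} (h : IsCanonicalFactorization m i₀ f₀ f g)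
    (hu : IsUnit (augmentation A _ (m i₀ i₀))) :
    ∃ f' g' : ι → AddMonoidAlgebra (integralClosure A L) (Fin n → ℤ),
      (∀ i, mapRingHom _ ((integralClosure A L).val : integralClosure A L →+* L) (f' i) = f i) ∧
      (∀ i, mapRingHom _ ((integralClosure A L).val : integralClosure A L →+* L) (g' i) = g i) ∧
      IsCanonicalFactorization m i₀ f₀ f' g' := by
  obtain ⟨f', g', hf', hg', -, -⟩ :=
    exists_integralClosure_factorization h.mul_eq h.augmentation_eq hu
  refine ⟨f', g', hf', hg', of_map (integralClosure A L).val Subtype.val_injective ?_⟩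
  simpa only [hf', hg'] using h

section

variable [Fintype ι] {F : Type*} [Field F] [Algebra A F]

/-- Canonical factorizations exist over fields. -/
theorem exists_of_field (hm : ∀ i j k l, m i j * m k l = m i l * m k j) (ht : ∑ i, m i i = 1)
    (hu : IsUnit (augmentation A _ (m i₀ i₀))) (h₁ : IsCanonicalFactorization m i₀ f₀ f₁ g₁) :
    ∃ f g : ι → AddMonoidAlgebra F (Fin n → ℤ), IsCanonicalFactorization m i₀ f₀ f g := by
  obtain ⟨f, g, hfg, hf⟩ := AddMonoidAlgebra.exists_eq_mul_of_minors (i₀ := i₀)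
    (m := fun i j ↦ mapRingHom (Fin n → ℤ) (algebraMap A F) (m i j))
    (fun i j k l ↦ by rw [← map_mul, hm, map_mul])
    (by rw [augmentation_mapRingHom]; exact (hu.map _).ne_zero)
  obtain ⟨f', g', -, -, hfg', hf'⟩ :=
    exists_integralClosure_factorization (fun i j ↦ (hfg i j).symm) hf hu
  obtain ⟨a, b, h⟩ := exists_of_isIntegral ht h₁ hfg' hf'
  exact ⟨_, _, h.map (integralClosure A F).val⟩

/-- Canonical factorizations over fields are unique. -/
theorem eq_of_field (ht : ∑ i, m i i = 1) (hu : IsUnit (augmentation A _ (m i₀ i₀)))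
    {f g f' g' : ι → AddMonoidAlgebra F (Fin n → ℤ)} (h : IsCanonicalFactorization m i₀ f₀ f g)
    (h' : IsCanonicalFactorization m i₀ f₀ f' g') : f = f' ∧ g = g' := by
  obtain ⟨a, b, ha, hb, hab⟩ := h.lift_integralClosure hu
  obtain ⟨a', b', ha', hb', hab'⟩ := h'.lift_integralClosure hu
  obtain ⟨rfl, rfl⟩ := hab.eq_of_isIntegral ht hab'
  exact ⟨funext fun i ↦ (ha i).symm.trans (ha' i), funext fun i ↦ (hb i).symm.trans (hb' i)⟩

/-- The supports of canonical factorizations over fields are uniformly bounded. -/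
theorem exists_finset_coeff_eq_zero (hu : IsUnit (augmentation A _ (m i₀ i₀)))
    (h₁ : IsCanonicalFactorization m i₀ f₀ f₁ g₁) :
    ∃ t : Finset (Fin n → ℤ), ∀ {F : Type*} [Field F] [Algebra A F]
      {f g : ι → AddMonoidAlgebra F (Fin n → ℤ)}, IsCanonicalFactorization m i₀ f₀ f g →
      ∀ i γ, γ ∉ t → (f i).coeff γ = 0 ∧ (g i).coeff γ = 0 := by
  classical
  let s := Finset.univ.biUnion fun p : ι × ι ↦ (m p.1 p.2).coeff.support
  have hs {F : Type _} [Field F] [Algebra A F] (i j : ι) (γ : Fin n → ℤ) (hγ : γ ∉ s) :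
      (mapRingHom _ (algebraMap A F) (m i j)).coeff γ = 0 := by
    have : (m i j).coeff γ = 0 := by
      by_contra hne
      exact hγ (Finset.mem_biUnion.2 ⟨(i, j), Finset.mem_univ _, Finsupp.mem_support_iff.2 hne⟩)
    simp [this]
  have hfg : f₁ i₀ * g₁ i₀ ≠ 0 := fun h0 ↦ by
    rw [h₁.mul_eq] at h0
    have := congr_arg (augmentation _ _) h0
    rw [augmentation_mapRingHom, map_zero] at this
    exact (hu.map _).ne_zero this
  obtain ⟨δ, hδ⟩ := exists_coeff_ne_zero (left_ne_zero_of_mul hfg)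
  obtain ⟨ε, hε⟩ := exists_coeff_ne_zero (right_ne_zero_of_mul hfg)
  obtain ⟨t₁, ht₁⟩ := AddMonoidAlgebra.exists_finset_coeff_eq_zero s δ
  obtain ⟨t₂, ht₂⟩ := AddMonoidAlgebra.exists_finset_coeff_eq_zero s ε
  refine ⟨t₁ ∪ t₂, fun {F _ _ f g} h i γ hγ ↦ ?_⟩
  rw [Finset.mem_union, not_or] at hγ
  suffices hne : (f i₀).coeff δ ≠ 0 ∧ (g i₀).coeff ε ≠ 0 by
    refine ⟨ht₂ hne.2 (fun η hη ↦ ?_) γ hγ.2, ht₁ hne.1 (fun η hη ↦ ?_) γ hγ.1⟩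
    · rw [h.mul_eq, hs i i₀ η hη]
    · rw [mul_comm, h.mul_eq, hs i₀ i η hη]
  obtain ⟨a, b, ha, hb, hab⟩ := h.lift_integralClosure hu
  have hne {x : AddMonoidAlgebra (integralClosure A F) (Fin n → ℤ)}
      {y : AddMonoidAlgebra F (Fin n → ℤ)} {η : Fin n → ℤ}
      (hxy : mapRingHom _ ((integralClosure A F).val : integralClosure A F →+* F) x = y)
      (hx : x.coeff η ≠ 0) : y.coeff η ≠ 0 := by
    rw [← hxy, coeff_mapRingHom]
    exact fun h0 ↦ hx (Subtype.val_injective h0)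
  exact ⟨hne (ha i₀) ((h₁.coeff_ne_zero_of_isIntegral hab i₀ δ).1 hδ),
    hne (hb i₀) ((h₁.coeff_ne_zero_of_isIntegral hab i₀ ε).2 hε)⟩

end

end IsCanonicalFactorization

end

section

variable (A B : Type*) [CommRing A] [CommRing B] [Algebra A B]

/-- The conductor of a ring homomorphism, as an ideal of the target. -/
def algebraConductor : Ideal B where
  carrier := {y | ∀ b, y * b ∈ (algebraMap A B).range}
  zero_mem' b := by rw [zero_mul]; exact zero_mem _
  add_mem' hx hy b := by rw [add_mul]; exact add_mem (hx b) (hy b)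
  smul_mem' c x hx b := by rw [smul_eq_mul, mul_right_comm, mul_comm, mul_comm c b]; exact hx _

variable {A B}

theorem IsSeminormalRing.isRadical_algebraConductor (hA : IsSeminormalRing A) [IsReduced B]
    (hinj : Function.Injective (algebraMap A B)) : (algebraConductor A B).IsRadical := by
  refine (Ideal.isRadical_iff_pow_one_lt 2 one_lt_two).2 fun y hy b ↦ ?_
  obtain ⟨a₂, h₂⟩ : (y * b) ^ 2 ∈ (algebraMap A B).range := by
    rw [mul_pow]; exact hy _
  obtain ⟨a₃, h₃⟩ : (y * b) ^ 3 ∈ (algebraMap A B).range := by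
    rw [show (y * b) ^ 3 = y ^ 2 * (y * b ^ 3) by ring]; exact hy _
  obtain ⟨a, rfl, rfl⟩ := hA.2 a₂ a₃ (hinj (by rw [map_pow, map_pow, h₂, h₃]; ring))
  rw [map_pow] at h₂ h₃
  refine ⟨a, sub_eq_zero.1 (eq_zero_of_pow_eq_zero (n := 3) ?_)⟩
  linear_combination (-3 * (algebraMap A B a + y * b)) * h₂ + 4 * h₃

/-- A finite integral extension of a seminormal ring with trivial residual behaviour at every
prime is trivial. -/
theorem IsSeminormalRing.algebraMap_surjective (hA : IsSeminormalRing A) [IsReduced B]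
    (hinj : Function.Injective (algebraMap A B)) {S : Set B} (hS : S.Finite)
    (hInt : ∀ c ∈ S, IsIntegral A c) (hadj : Algebra.adjoin A S = ⊤)
    (h : ∀ p : Ideal A, p.IsPrime → ∀ c ∈ S, ∃ s ∉ p, ∃ a, ∀ q : Ideal B, q.IsPrime →
      q.comap (algebraMap A B) = p → algebraMap A B s * c - algebraMap A B a ∈ q) :
    Function.Surjective (algebraMap A B) := by
  set C := algebraConductor A B with hC
  have hrad : C.IsRadical := hA.isRadical_algebraConductor hinj
  suffices hone : (1 : A) ∈ C.comap (algebraMap A B) by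
    intro b
    obtain ⟨a, ha⟩ := hone b
    exact ⟨a, by rw [ha, map_one, one_mul]⟩
  rw [← Ideal.eq_top_iff_one]
  by_contra hne
  obtain ⟨p, hp⟩ := Ideal.nonempty_minimalPrimes hne
  have hpp : p.IsPrime := hp.1.1
  have hloc (c : B) (hc : c ∈ S) : ∃ t ∉ p, algebraMap A B t * c ∈ (algebraMap A B).range := by
    obtain ⟨s, hs, a, hsa⟩ := h p hpp c hc
    obtain ⟨x, hx⟩ : ∃ x, x = algebraMap A B s * c - algebraMap A B a := ⟨_, rfl⟩
    simp_rw [← hx] at hsa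
    obtain ⟨s', hs', k, hk⟩ : ∃ s' ∉ p, ∃ k : ℕ, algebraMap A B s' * x ^ k ∈ C := by
      by_contra! hcon
      have hdisj : Disjoint (C : Set B)
          (p.primeCompl.map (algebraMap A B) ⊔ Submonoid.powers x : Submonoid B) := by
        rw [Set.disjoint_left]
        intro y hy hyM
        obtain ⟨_, ⟨s', hs', rfl⟩, _, ⟨k, rfl⟩, rfl⟩ := Submonoid.mem_sup.1 hyM
        exact hcon s' hs' k hy
      obtain ⟨q, hq, hCq, hqM⟩ := Ideal.exists_le_prime_disjoint _ _ hdisj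
      rw [Set.disjoint_left] at hqM
      have hqp : q.comap (algebraMap A B) ≤ p := fun r hr ↦ by
        by_contra hrp
        exact hqM hr ((le_sup_left : _ ≤ p.primeCompl.map (algebraMap A B) ⊔ Submonoid.powers x)
          ⟨r, hrp, rfl⟩)
      have hpq := hp.2 ⟨Ideal.IsPrime.comap _, Ideal.comap_mono hCq⟩ hqp
      exact hqM (hsa q hq (le_antisymm hqp hpq))
        ((le_sup_right : _ ≤ p.primeCompl.map (algebraMap A B) ⊔ Submonoid.powers x)
          (Submonoid.mem_powers x))
    have hsx : algebraMap A B s' * x ∈ C := by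
      refine hrad ⟨k + 1, ?_⟩
      rw [show (algebraMap A B s' * x) ^ (k + 1) =
        (algebraMap A B s' ^ k * x) * (algebraMap A B s' * x ^ k) by ring]
      exact C.mul_mem_left _ hk
    obtain ⟨r, hr⟩ := hsx 1
    refine ⟨s' * s, fun hmem ↦ (hpp.mem_or_mem hmem).elim hs' hs, r + s' * a, ?_⟩
    rw [map_add, hr, map_mul, map_mul, hx]
    ring
  let D : Subalgebra A B :=
    { carrier := {b | ∃ t ∉ p, algebraMap A B t * b ∈ (algebraMap A B).range}
      algebraMap_mem' r := ⟨1, hpp.one_notMem, r, by simp⟩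
      add_mem' := by
        rintro a b ⟨s, hs, x, hx⟩ ⟨t, ht, y, hy⟩
        refine ⟨s * t, fun hmem ↦ (hpp.mem_or_mem hmem).elim hs ht, t * x + s * y, ?_⟩
        rw [map_add, map_mul, map_mul, hx, hy, map_mul]
        ring
      mul_mem' := by
        rintro a b ⟨s, hs, x, hx⟩ ⟨t, ht, y, hy⟩
        refine ⟨s * t, fun hmem ↦ (hpp.mem_or_mem hmem).elim hs ht, x * y, ?_⟩
        rw [map_mul, hx, hy, map_mul]
        ring }
  have hD : ∀ b, b ∈ D := fun b ↦ by
    have h1 : Algebra.adjoin A S ≤ D := Algebra.adjoin_le hloc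
    exact h1 (hadj ▸ Algebra.mem_top)
  obtain ⟨T, hT⟩ : (⊤ : Submodule A B).FG := by
    have := fg_adjoin_of_finite hS hInt
    rwa [hadj] at this
  choose t htp ht using hD
  refine (Ideal.IsPrime.prod_mem_iff (s := T) (x := t) (p := p)).not.2 ?_ (hp.1.2 fun b ↦ ?_)
  · rintro ⟨b, -, hb⟩
    exact htp b hb
  · have hb : b ∈ Submodule.span A (T : Set B) := hT ▸ Submodule.mem_top
    induction hb using Submodule.span_induction with
    | zero => rw [mul_zero]; exact zero_mem _
    | add x y _ _ hx hy => rw [mul_add]; exact add_mem hx hy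
    | smul a x _ hx =>
      rw [Algebra.smul_def, mul_left_comm]; exact mul_mem ⟨a, rfl⟩ hx
    | mem x hx =>
      obtain ⟨r, hr⟩ := Finset.dvd_prod_of_mem t hx
      rw [hr, map_mul, mul_right_comm]
      exact mul_mem (ht x) ⟨r, rfl⟩

end

section

open IsLocalRing AddMonoidAlgebra

theorem AddMonoidAlgebra.exists_mapRingHom_evalRingHom_eq {κ Γ : Type*} [AddCommGroup Γ]
    {F : κ → Type*} [∀ k, CommRing (F k)] (t : Finset Γ) (x : ∀ k, AddMonoidAlgebra (F k) Γ)
    (hx : ∀ k γ, γ ∉ t → (x k).coeff γ = 0) :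
    ∃ y : AddMonoidAlgebra (∀ k, F k) Γ, ∀ k, mapRingHom Γ (Pi.evalRingHom F k) y = x k := by
  refine ⟨∑ γ ∈ t, single γ fun k ↦ (x k).coeff γ, fun k ↦ ?_⟩
  simp_rw [map_sum, mapRingHom_single, Pi.evalRingHom_apply]
  conv_rhs => rw [← sum_coeff_single (x k)]
  refine (Finset.sum_subset (fun γ hγ ↦ ?_) fun γ _ hγ ↦ ?_).symm
  · by_contra h
    exact Finsupp.mem_support_iff.1 hγ (hx k γ h)
  · rw [Finsupp.notMem_support_iff.1 hγ, single_zero]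

/-- An element of the residue field at `p` is a fraction of elements of the base ring. -/
theorem Ideal.ResidueField.exists_algebraMap_mul_eq {A : Type*} [CommRing A] (p : Ideal A)
    [p.IsPrime] (c : p.ResidueField) :
    ∃ s ∉ p, ∃ a, algebraMap A p.ResidueField s * c = algebraMap A p.ResidueField a := by
  obtain ⟨a, s, hs, rfl⟩ := IsFractionRing.div_surjective (A := A ⧸ p) c
  obtain ⟨a, rfl⟩ := Ideal.Quotient.mk_surjective a
  obtain ⟨s, rfl⟩ := Ideal.Quotient.mk_surjective s
  have hsp : s ∉ p := fun h ↦ nonZeroDivisors.ne_zero hs (Ideal.Quotient.eq_zero_iff_mem.2 h)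
  refine ⟨s, hsp, a, ?_⟩
  rw [Ideal.algebraMap_quotient_residueField_mk, Ideal.algebraMap_quotient_residueField_mk]
  exact mul_div_cancel₀ _ (Ideal.algebraMap_residueField_eq_zero.not.2 hsp)

namespace IsCanonicalFactorization

section

variable {A : Type*} [CommRing A] [IsLocalRing A] {n : ℕ} {ι : Type*}
  {m : ι → ι → AddMonoidAlgebra A (Fin n → ℤ)} {i₀ : ι}

theorem exists_residueField [Finite ι] (hm : ∀ i j k l, m i j * m k l = m i l * m k j)
    (hu : IsUnit (augmentation A _ (m i₀ i₀))) :
    ∃ (f₀ : ι → AddMonoidAlgebra A (Fin n → ℤ))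
      (f₁ g₁ : ι → AddMonoidAlgebra (ResidueField A) (Fin n → ℤ)),
      IsCanonicalFactorization m i₀ f₀ f₁ g₁ := by
  obtain ⟨f, g, hfg, hf⟩ := AddMonoidAlgebra.exists_eq_mul_of_minors (i₀ := i₀)
    (m := fun i j ↦ mapRingHom (Fin n → ℤ) (algebraMap A (ResidueField A)) (m i j))
    (fun i j k l ↦ by rw [← map_mul, hm, map_mul])
    (by rw [augmentation_mapRingHom]; exact (hu.map _).ne_zero)
  choose f₀ hf₀ using fun i ↦ exists_mapRingHom_eq (algebraMap A (ResidueField A)) (f i)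
    fun γ ↦ residue_surjective _
  refine ⟨f₀, f, g, fun i j ↦ (hfg i j).symm, hf, fun i γ ↦ ?_⟩
  rw [← hf₀ i, coeff_mapRingHom, sub_self]
  exact isResiduallyNilpotent_zero

end

variable {A : Type*} [CommRing A] [HenselianLocalRing A] {n : ℕ} {ι : Type*} [Fintype ι]
  {m : ι → ι → AddMonoidAlgebra A (Fin n → ℤ)} {i₀ : ι} {f₀ : ι → AddMonoidAlgebra A (Fin n → ℤ)}
  {f₁ g₁ : ι → AddMonoidAlgebra (ResidueField A) (Fin n → ℤ)}

/-- Canonical factorizations exist over products of fields. -/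
theorem exists_of_pi {κ : Type*} (F : κ → Type*) [∀ k, Field (F k)] [∀ k, Algebra A (F k)]
    (hm : ∀ i j k l, m i j * m k l = m i l * m k j) (ht : ∑ i, m i i = 1)
    (hu : IsUnit (augmentation A _ (m i₀ i₀))) (h₁ : IsCanonicalFactorization m i₀ f₀ f₁ g₁) :
    ∃ f g : ι → AddMonoidAlgebra (∀ k, F k) (Fin n → ℤ),
      IsCanonicalFactorization m i₀ f₀ f g := by
  choose a b hab using fun k ↦ exists_of_field (F := F k) hm ht hu h₁
  obtain ⟨t, ht⟩ := exists_finset_coeff_eq_zero hu h₁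
  choose f hf using fun i ↦ exists_mapRingHom_evalRingHom_eq t (fun k ↦ a k i)
    fun k γ hγ ↦ (ht (hab k) i γ hγ).1
  choose g hg using fun i ↦ exists_mapRingHom_evalRingHom_eq t (fun k ↦ b k i)
    fun k γ hγ ↦ (ht (hab k) i γ hγ).2
  have hcoeff (x : AddMonoidAlgebra (∀ k, F k) (Fin n → ℤ)) (k γ) :
      x.coeff γ k = (mapRingHom _ (Pi.evalRingHom F k) x).coeff γ := by
    rw [coeff_mapRingHom, Pi.evalRingHom_apply]
  have hmul (i j) : f i * g j = mapRingHom _ (algebraMap A (∀ k, F k)) (m i j) := by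
    apply coeff_injective
    ext γ k
    rw [hcoeff, hcoeff, map_mul, hf, hg, (hab k).mul_eq, ← RingHom.comp_apply, ← mapRingHom_comp]
    rfl
  have haug : augmentation (∀ k, F k) _ (f i₀) = 1 := by
    funext k
    have := augmentation_mapRingHom (Pi.evalRingHom F k) (f i₀)
    rw [hf, (hab k).augmentation_eq] at this
    exact this.symm
  refine ⟨f, g, hmul, haug, fun i γ ↦ isResiduallyNilpotent_pi ?_ fun k ↦ ?_⟩
  · exact (isIntegral_coeff_of_factorization hmul haug hu i γ).1.sub isIntegral_algebraMap
  · rw [Pi.sub_apply, hcoeff, hf]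
    exact (hab k).residual i γ

/-- Canonical factorizations exist over seminormal rings. -/
theorem exists_of_isSeminormalRing (hA : IsSeminormalRing A)
    (hm : ∀ i j k l, m i j * m k l = m i l * m k j) (ht : ∑ i, m i i = 1)
    (hu : IsUnit (augmentation A _ (m i₀ i₀))) :
    ∃ f g : ι → AddMonoidAlgebra A (Fin n → ℤ), ∀ i j, f i * g j = m i j := by
  obtain ⟨f₀, f₁, g₁, h₁⟩ := exists_residueField hm hu
  have : IsReduced A := hA.1
  let F (p : PrimeSpectrum A) := p.asIdeal.ResidueField
  obtain ⟨f, g, h⟩ := exists_of_pi F hm ht hu h₁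
  let S₀ : Set (∀ p, F p) := ⋃ i, (Set.range (f i).coeff ∪ Set.range (g i).coeff)
  let B := Algebra.adjoin A S₀
  let S : Set B := (↑) ⁻¹' S₀
  have hInt (c) (hc : c ∈ S₀) : IsIntegral A c := by
    obtain ⟨i, ⟨γ, rfl⟩ | ⟨γ, rfl⟩⟩ := Set.mem_iUnion.1 hc
    exacts [(isIntegral_coeff_of_factorization h.mul_eq h.augmentation_eq hu i γ).1,
      (isIntegral_coeff_of_factorization h.mul_eq h.augmentation_eq hu i γ).2]
  have hfS (i γ) : (f i).coeff γ ∈ S₀ := Set.mem_iUnion.2 ⟨i, .inl ⟨γ, rfl⟩⟩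
  have hgS (i γ) : (g i).coeff γ ∈ S₀ := Set.mem_iUnion.2 ⟨i, .inr ⟨γ, rfl⟩⟩
  choose fB hfB using fun i ↦ exists_mapRingHom_eq (B.val : B →+* ∀ p, F p) (f i)
    fun γ ↦ ⟨⟨_, Algebra.subset_adjoin (hfS i γ)⟩, rfl⟩
  choose gB hgB using fun i ↦ exists_mapRingHom_eq (B.val : B →+* ∀ p, F p) (g i)
    fun γ ↦ ⟨⟨_, Algebra.subset_adjoin (hgS i γ)⟩, rfl⟩
  have hB : IsCanonicalFactorization m i₀ f₀ fB gB :=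
    of_map B.val Subtype.val_injective (by simpa only [hfB, hgB] using h)
  have hinj : Function.Injective (algebraMap A (∀ p, F p)) := by
    rw [injective_iff_map_eq_zero]
    refine fun a ha ↦ (nilpotent_iff_mem_prime.2 fun p hp ↦ ?_ : IsNilpotent a).eq_zero
    exact Ideal.algebraMap_residueField_eq_zero.1 (congr_fun ha ⟨p, hp⟩)
  have hinjB : Function.Injective (algebraMap A B) := fun a b hab ↦
    hinj (congr_arg Subtype.val hab)
  have : IsReduced B := isReduced_of_injective B.val Subtype.val_injective
  have hcoeff (c : B) (hc : c ∈ S) : ∃ i γ, c = (fB i).coeff γ ∨ c = (gB i).coeff γ := by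
    obtain ⟨i, ⟨γ, hγ⟩ | ⟨γ, hγ⟩⟩ := Set.mem_iUnion.1 hc
    · refine ⟨i, γ, .inl (Subtype.ext ?_)⟩
      rw [← hγ, ← hfB, coeff_mapRingHom]; rfl
    · refine ⟨i, γ, .inr (Subtype.ext ?_)⟩
      rw [← hγ, ← hgB, coeff_mapRingHom]; rfl
  have hres (p : Ideal A) (hp : p.IsPrime) (q : Ideal B) (hq : q.IsPrime)
      (hpq : p = q.comap (Algebra.ofId A B).toRingHom) (c : B) (hc : c ∈ S) :
      algebraMap B q.ResidueField c =
        Ideal.ResidueField.mapₐ p q (Algebra.ofId A B) hpq ((c : ∀ p, F p) ⟨p, hp⟩) := by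
    let φ : B →ₐ[A] q.ResidueField := IsScalarTower.toAlgHom A B _
    let ψ : B →ₐ[A] q.ResidueField := (Ideal.ResidueField.mapₐ p q (Algebra.ofId A B) hpq).comp
      ((Pi.evalAlgHom A F ⟨p, hp⟩).comp B.val)
    obtain ⟨e₁, e₂⟩ := eq_of_field ht hu (hB.map φ) (hB.map ψ)
    change φ c = ψ c
    obtain ⟨i, γ, rfl | rfl⟩ := hcoeff c hc
    · have := congr_arg (fun x ↦ x.coeff γ) (congr_fun e₁ i)
      simp only [coeff_mapRingHom] at this
      exact this
    · have := congr_arg (fun x ↦ x.coeff γ) (congr_fun e₂ i)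
      simp only [coeff_mapRingHom] at this
      exact this
  have hsurj : Function.Surjective (algebraMap A B) := by
    refine hA.algebraMap_surjective hinjB (S := S) ?_ ?_ ?_ ?_
    · refine Set.Finite.preimage Subtype.val_injective.injOn (Set.finite_iUnion fun i ↦ ?_)
      exact (f i).coeff.finite_range.union (g i).coeff.finite_range
    · exact fun c hc ↦ (isIntegral_algHom_iff B.val Subtype.val_injective).1 (hInt c hc)
    · exact Algebra.adjoin_adjoin_coe_preimage
    · intro p hp c hc
      obtain ⟨s, hs, a, hsa⟩ := Ideal.ResidueField.exists_algebraMap_mul_eq p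
        ((c : ∀ p, F p) ⟨p, hp⟩)
      refine ⟨s, hs, a, fun q hq hqp ↦ ?_⟩
      rw [← Ideal.algebraMap_residueField_eq_zero, map_sub, map_mul, hres p hp q hq hqp.symm c hc,
        sub_eq_zero, ← IsScalarTower.algebraMap_apply, ← IsScalarTower.algebraMap_apply,
        ← AlgHom.commutes (Ideal.ResidueField.mapₐ p q (Algebra.ofId A B) hqp.symm), ← map_mul, hsa,
        AlgHom.commutes]
  choose f' hf' using fun i ↦ exists_mapRingHom_eq (algebraMap A B) (fB i) fun γ ↦ hsurj _
  choose g' hg' using fun i ↦ exists_mapRingHom_eq (algebraMap A B) (gB i) fun γ ↦ hsurj _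
  refine ⟨f', g', fun i j ↦ mapRingHom_injective _ hinjB ?_⟩
  rw [map_mul, hf', hg', hB.mul_eq]

end IsCanonicalFactorization

end

section

variable {R P : Type*} [CommRing R] [AddCommGroup P] [Module R P] [Module.Invertible R P]

theorem Module.Invertible.exists_dual_apply_sum_eq_one :
    ∃ s : Finset (Module.Dual R P × P), ∑ i : s, i.1.1 i.1.2 = 1 := by
  obtain ⟨s, hs⟩ := TensorProduct.exists_finset ((linearEquiv R P).symm 1)
  refine ⟨s, ?_⟩
  rw [Finset.sum_coe_sort s fun i ↦ i.1 i.2, ← (linearEquiv R P).apply_symm_apply 1, hs, map_sum]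
  rfl

theorem Module.Invertible.dual_apply_mul_dual_apply (φ ψ : Module.Dual R P) (p q : P) :
    φ p * ψ q = φ q * ψ p := by
  have := congr_arg (LinearMap.mul' R R ∘ₗ TensorProduct.map φ ψ)
    (Module.Invertible.tmul_comm (R := R) (m₁ := p) (m₂ := q))
  simpa using this

/-- An invertible module is trivial if a presenting rank-one matrix is a column times a row. -/
theorem Module.Invertible.nonempty_linearEquiv {ι : Type*} [Fintype ι] (φ : ι → Module.Dual R P)
    (p : ι → P) (h : ∑ i, φ i (p i) = 1) {f g : ι → R} (hfg : ∀ i j, f i * g j = φ i (p j)) :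
    Nonempty (P ≃ₗ[R] R) := by
  suffices hs : Function.Surjective (∑ i, g i • φ i : P →ₗ[R] R) from
    ⟨.ofBijective _ (bijective_of_surjective hs)⟩
  intro r
  refine ⟨r • ∑ j, f j • p j, ?_⟩
  simp_rw [← hfg] at h
  have h' : ∑ i, g i * f i = 1 := by simpa only [mul_comm] using h
  have key (i) : (g i • φ i) (∑ j, f j • p j) = g i * f i := by
    simp_rw [LinearMap.smul_apply, map_sum, map_smul, ← hfg, smul_eq_mul]
    rw [Finset.sum_congr rfl fun j _ ↦ mul_left_comm (f j) (f i) (g j), ← Finset.mul_sum, h,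
      mul_one]
  rw [map_smul, LinearMap.sum_apply, Finset.sum_congr rfl fun i _ ↦ key i, h', smul_eq_mul, mul_one]

end

/-- Let `A` be a henselian local ring whose spectrum is seminormal and
`T = 𝔾ₘⁿ` a split torus.  Then `Pic(A[t₁,…,tₙ,t₁⁻¹,…,tₙ⁻¹]) = 0`: every invertible
module over the Laurent polynomial ring `A[ℤⁿ] = A[t₁,…,tₙ,t₁⁻¹,…,tₙ⁻¹]` is trivial. -/
theorem pic_laurent_henselian_seminormal_eq_zero
    (A : Type u) [CommRing A] [IsLocalRing A] [HenselianLocalRing A]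
    (hA : IsSeminormalRing A) (n : ℕ)
    (P : Type u) [AddCommGroup P] [Module (AddMonoidAlgebra A (Fin n → ℤ)) P]
    (hP : IsInvertibleModule (AddMonoidAlgebra A (Fin n → ℤ)) P) :
    Nonempty (P ≃ₗ[AddMonoidAlgebra A (Fin n → ℤ)] AddMonoidAlgebra A (Fin n → ℤ)) := by
  obtain ⟨N, _, _, ⟨e⟩⟩ := hP
  have := Module.Invertible.left e
  obtain ⟨s, hs⟩ := Module.Invertible.exists_dual_apply_sum_eq_one
    (R := AddMonoidAlgebra A (Fin n → ℤ)) (P := P)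
  have hs' := congr_arg (AddMonoidAlgebra.augmentation A _) hs
  rw [map_sum, map_one] at hs'
  obtain ⟨i₀, -, hu⟩ := IsLocalRing.exists_of_isUnit_sum (hs' ▸ isUnit_one)
  obtain ⟨f, g, hfg⟩ := IsCanonicalFactorization.exists_of_isSeminormalRing hA
    (m := fun i j : s ↦ i.1.1 j.1.2)
    (fun i j k l ↦ Module.Invertible.dual_apply_mul_dual_apply _ _ _ _) hs hu
  exact Module.Invertible.nonempty_linearEquiv (fun i : s ↦ i.1.1) (fun i ↦ i.1.2) hs hfg
end
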